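/- arXiv:math/0109132 — 6 statements merged into one kernel-verified Lean document; each statement's English description precedes it below -/
import Mathlib

section
/- Let L be a Lie algebra over ℂ and φ : L → L a Lie algebra automorphism. Define the linear maps Q₊ := φ + φ⁻¹ and Q₋ := φ − φ⁻¹. Then for all ξ, η ∈ L: Q₋([Q₋ξ, Q₋η]) + Q₋([Q₊ξ, Q₊η]) − Q₊([Q₋ξ, Q₊η] + [Q₊ξ, Q₋η]) = 0. (This is the identity, eq. (2.13), that verifies the modified classical dynamical Yang–Baxter equation for homogeneous elements of nonzero grade in Theorem 1, applied with φ = e^{(1/2)ad κ}.) -/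
/-- Let `L` be a Lie algebra over `ℂ` and `φ : L → L` a Lie algebra
automorphism.  Define `Q₊ := φ + φ⁻¹` and `Q₋ := φ − φ⁻¹`.  Then for all `ξ η ∈ L`:
`Q₋[Q₋ξ, Q₋η] + Q₋[Q₊ξ, Q₊η] − Q₊([Q₋ξ, Q₊η] + [Q₊ξ, Q₋η]) = 0`. -/
theorem felder_eq_2_13 (L : Type*) [LieRing L] [LieAlgebra ℂ L]
    (φ : L ≃ₗ⁅ℂ⁆ L) (Qp Qm : L → L)
    (hQp : ∀ x, Qp x = φ x + φ.symm x)
    (hQm : ∀ x, Qm x = φ x - φ.symm x)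
    (ξ η : L) :
    Qm ⁅Qm ξ, Qm η⁆ + Qm ⁅Qp ξ, Qp η⁆ - Qp (⁅Qm ξ, Qp η⁆ + ⁅Qp ξ, Qm η⁆) = 0 := by
  have h₁ : φ ⁅φ.symm ξ, φ.symm η⁆ = ⁅ξ, η⁆ := by
    rw [LieEquiv.map_lie, LieEquiv.apply_symm_apply, LieEquiv.apply_symm_apply]
  have h₂ : φ.symm ⁅φ ξ, φ η⁆ = ⁅ξ, η⁆ := by
    rw [LieEquiv.map_lie, LieEquiv.symm_apply_apply, LieEquiv.symm_apply_apply]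
  simp only [hQp, hQm, add_lie, lie_add, sub_lie, lie_sub, map_add, map_sub, h₁, h₂]
  abel
end

section
/- Let Im τ > 0 and let w, z ∈ ℂ satisfy: −Im τ < Im z < 0; w/2 + πiτn ∉ πiℤ for every n ∈ ℤ; θ₁(z|τ) ≠ 0; and θ₁(w/(2πi)|τ) ≠ 0. Then the family n ↦ (1/2)·e^{2πizn}·(1 + coth(w/2 + πiτn)), indexed by n ∈ ℤ, is absolutely summable, and ∑_{n∈ℤ} (1/2)·e^{2πizn}·(1 + coth(w/2 + πiτn)) = χ(w,z|τ). -/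
open Complex

/-- The theta function `θ₁(z|τ) = −∑_{j∈ℤ} exp(πi(j+1/2)²τ + 2πi(j+1/2)(z+1/2))`. -/
noncomputable def theta1 (z τ : ℂ) : ℂ :=
  -∑' j : ℤ, Complex.exp ((Real.pi : ℂ) * I * ((j : ℂ) + 1 / 2) ^ 2 * τ +
      2 * (Real.pi : ℂ) * I * ((j : ℂ) + 1 / 2) * (z + 1 / 2))

/-- The derivative `θ₁'(z|τ)` of `θ₁` in its first variable. -/
noncomputable def theta1Deriv (z τ : ℂ) : ℂ := deriv (fun u => theta1 u τ) z

/-- The hyperbolic cotangent `coth u = cosh u / sinh u`. -/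
noncomputable def coth (u : ℂ) : ℂ := Complex.cosh u / Complex.sinh u

/-- `χ(w,z|τ) := (1/(2πi)) · θ₁(w/(2πi) + z|τ) · θ₁'(0|τ) / (θ₁(z|τ) · θ₁(w/(2πi)|τ))`. -/
noncomputable def chi (w z τ : ℂ) : ℂ :=
  (1 / (2 * (Real.pi : ℂ) * I)) * theta1 (w / (2 * (Real.pi : ℂ) * I) + z) τ *
    theta1Deriv 0 τ / (theta1 z τ * theta1 (w / (2 * (Real.pi : ℂ) * I)) τ)

/-- `χ_a(w,z|τ) := exp(2πiaz/N)·(χ(w + 2πi(a/N)τ, z|τ) − δ_{a,0}/w)`. -/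
noncomputable def chia (N a : ℕ) (w z τ : ℂ) : ℂ :=
  Complex.exp (2 * (Real.pi : ℂ) * I * (a : ℂ) * z / (N : ℂ)) *
    (chi (w + 2 * (Real.pi : ℂ) * I * ((a : ℂ) / (N : ℂ)) * τ) z τ -
      if a = 0 then 1 / w else 0)

open Filter Topology

/-- The summand of the Kronecker series in multiplicative coordinates. -/
noncomputable def kroneckerTerm (q a y : ℂ) (n : ℤ) : ℂ :=
  y ^ (-n) * (1 - a⁻¹ * q ^ n)⁻¹

lemma tendsto_inv_one_sub_mul_pow {q : ℂ} (hq : ‖q‖ < 1) (v : ℂ) :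
    Tendsto (fun n : ℕ => (1 - v * q ^ n)⁻¹) atTop (𝓝 1) := by
  have h := ((tendsto_pow_atTop_nhds_zero_of_norm_lt_one hq).const_mul v).const_sub 1
  simpa using h.inv₀ (by simp)

lemma exists_norm_inv_one_sub_mul_pow_le {q : ℂ} (hq : ‖q‖ < 1) (v : ℂ) :
    ∃ C : ℝ, ∀ n : ℕ, ‖(1 - v * q ^ n)⁻¹‖ ≤ C := by
  obtain ⟨C, hC⟩ := (tendsto_inv_one_sub_mul_pow hq v).norm.bddAbove_range
  exact ⟨C, fun n => hC ⟨n, rfl⟩⟩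

lemma summable_norm_pow_mul_inv_one_sub {q u : ℂ} (hq : ‖q‖ < 1) (hu : ‖u‖ < 1) (v : ℂ) :
    Summable (fun n : ℕ => ‖u ^ n * (1 - v * q ^ n)⁻¹‖) := by
  obtain ⟨C, hC⟩ := exists_norm_inv_one_sub_mul_pow_le hq v
  refine Summable.of_nonneg_of_le (fun _ => norm_nonneg _) (fun n => ?_)
    ((summable_geometric_of_lt_one (norm_nonneg u) hu).mul_right C)
  rw [norm_mul, norm_pow]
  gcongr
  exact hC n

/-- The Lambert-type series `∑ uⁿ / (1 - v qⁿ)` is symmetric in `u` and `v`. -/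
lemma tsum_pow_mul_inv_one_sub_comm {q u v : ℂ} (hq : ‖q‖ < 1) (hu : ‖u‖ < 1) (hv : ‖v‖ < 1) :
    ∑' n : ℕ, u ^ n * (1 - v * q ^ n)⁻¹ = ∑' n : ℕ, v ^ n * (1 - u * q ^ n)⁻¹ := by
  have expand : ∀ {u v : ℂ}, ‖v‖ < 1 → ∀ n : ℕ,
      u ^ n * (1 - v * q ^ n)⁻¹ = ∑' k : ℕ, u ^ n * v ^ k * q ^ (n * k) := by
    intro u v hv n
    have h1 : ‖v * q ^ n‖ < 1 := by
      rw [norm_mul, norm_pow]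
      exact mul_lt_one_of_nonneg_of_lt_one_left (norm_nonneg _) hv
        (pow_le_one₀ (norm_nonneg _) hq.le)
    rw [← tsum_geometric_of_norm_lt_one h1, ← tsum_mul_left]
    refine tsum_congr fun k => ?_
    rw [mul_pow, ← pow_mul, mul_assoc]
  have hs : Summable (Function.uncurry fun n k : ℕ => u ^ n * v ^ k * q ^ (n * k)) := by
    refine Summable.of_norm_bounded
      ((summable_geometric_of_lt_one (norm_nonneg u) hu).mul_of_nonneg
        (summable_geometric_of_lt_one (norm_nonneg v) hv)
        (fun _ => by positivity) (fun _ => by positivity)) ?_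
    rintro ⟨n, k⟩
    simp only [Function.uncurry, norm_mul, norm_pow]
    exact mul_le_of_le_one_right (by positivity) (pow_le_one₀ (norm_nonneg _) hq.le)
  rw [tsum_congr (expand hv), tsum_congr (expand hu), ← hs.tsum_comm]
  refine tsum_congr fun k => tsum_congr fun n => ?_
  rw [mul_comm (v ^ k), mul_comm n k]

lemma kroneckerTerm_natCast (q a y : ℂ) (n : ℕ) :
    kroneckerTerm q a y n = y⁻¹ ^ n * (1 - a⁻¹ * q ^ n)⁻¹ := by
  simp [kroneckerTerm]

lemma kroneckerTerm_neg_succ {q a : ℂ} (y : ℂ) (hq : q ≠ 0) (ha : a ≠ 0) (n : ℕ) :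
    kroneckerTerm q a y (-((n : ℤ) + 1)) =
      -(y * a * q) * ((y * q) ^ n * (1 - a * q * q ^ n)⁻¹) := by
  have h : 1 - a⁻¹ * q ^ (-((n : ℤ) + 1)) = -(a⁻¹ * (q ^ (n + 1))⁻¹) * (1 - a * q * q ^ n) := by
    rw [zpow_neg, ← Nat.cast_succ, zpow_natCast]
    field_simp
    rw [pow_succ]
    ring
  rw [kroneckerTerm, h, mul_inv, neg_neg, ← Nat.cast_succ, zpow_natCast, inv_neg, mul_inv,
    inv_inv, inv_inv, pow_succ, pow_succ]
  ring

lemma summable_norm_kroneckerTerm {q a y : ℂ} (hq0 : q ≠ 0) (hq : ‖q‖ < 1) (ha : a ≠ 0)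
    (hy : 1 < ‖y‖) (hyq : ‖y * q‖ < 1) : Summable (fun n => ‖kroneckerTerm q a y n‖) := by
  refine Summable.of_nat_of_neg_add_one ?_ ?_
  · simp_rw [kroneckerTerm_natCast]
    exact summable_norm_pow_mul_inv_one_sub hq (by rw [norm_inv]; exact inv_lt_one_of_one_lt₀ hy) _
  · simp_rw [kroneckerTerm_neg_succ y hq0 ha, norm_mul (-(y * a * q))]
    exact (summable_norm_pow_mul_inv_one_sub hq hyq _).mul_left _

lemma tsum_kroneckerTerm_eq {q a y : ℂ} (hq0 : q ≠ 0) (hq : ‖q‖ < 1) (ha : a ≠ 0)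
    (hy : 1 < ‖y‖) (hyq : ‖y * q‖ < 1) :
    ∑' n, kroneckerTerm q a y n = ∑' n : ℕ, y⁻¹ ^ n * (1 - a⁻¹ * q ^ n)⁻¹ +
      -(y * a * q) * ∑' n : ℕ, (y * q) ^ n * (1 - a * q * q ^ n)⁻¹ := by
  have hs := (summable_norm_kroneckerTerm hq0 hq ha hy hyq).of_norm
  rw [tsum_of_nat_of_neg_add_one (hs.comp_injective Nat.cast_injective)
    (hs.comp_injective (i := fun n : ℕ => -((n : ℤ) + 1)) fun m n h => by simpa using h),
    ← tsum_mul_left]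
  simp_rw [kroneckerTerm_natCast, kroneckerTerm_neg_succ y hq0 ha]

lemma tsum_kroneckerTerm_comm {q a y : ℂ} (hq0 : q ≠ 0) (hq : ‖q‖ < 1)
    (ha : 1 < ‖a‖) (haq : ‖a * q‖ < 1) (hy : 1 < ‖y‖) (hyq : ‖y * q‖ < 1) :
    ∑' n, kroneckerTerm q a y n = ∑' n, kroneckerTerm q y a n := by
  have ha0 : a ≠ 0 := norm_pos_iff.1 (one_pos.trans ha)
  have hy0 : y ≠ 0 := norm_pos_iff.1 (one_pos.trans hy)
  have inv_lt : ∀ {x : ℂ}, 1 < ‖x‖ → ‖x⁻¹‖ < 1 := fun h => by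
    rw [norm_inv]; exact inv_lt_one_of_one_lt₀ h
  rw [tsum_kroneckerTerm_eq hq0 hq ha0 hy hyq, tsum_kroneckerTerm_eq hq0 hq hy0 ha haq,
    tsum_pow_mul_inv_one_sub_comm hq (inv_lt hy) (inv_lt ha),
    tsum_pow_mul_inv_one_sub_comm hq hyq haq, mul_comm y a]

/-- The Appell-type series `∑ tⱼ / (1 - b⁻¹ qʲ)`. -/
noncomputable def appellSum (t : ℤ → ℂ) (q b : ℂ) : ℂ :=
  ∑' j : ℤ, t j * (1 - b⁻¹ * q ^ j)⁻¹

lemma exists_norm_inv_one_sub_mul_zpow_le {q b : ℂ} (hq0 : q ≠ 0) (hq : ‖q‖ < 1) (hb : b ≠ 0) :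
    ∃ C : ℝ, ∀ j : ℤ, ‖(1 - b⁻¹ * q ^ j)⁻¹‖ ≤ C := by
  obtain ⟨C, hC⟩ := exists_norm_inv_one_sub_mul_pow_le hq b⁻¹
  obtain ⟨C', hC'⟩ := exists_norm_inv_one_sub_mul_pow_le hq (b * q)
  refine ⟨max C (‖b * q‖ * C'), fun j => ?_⟩
  obtain ⟨n, rfl⟩ | ⟨n, rfl⟩ : (∃ n : ℕ, j = n) ∨ ∃ n : ℕ, j = -((n : ℤ) + 1) := by
    rcases le_or_gt 0 j with h | h
    · exact .inl ⟨j.toNat, by lia⟩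
    · exact .inr ⟨(-j - 1).toNat, by lia⟩
  · exact le_max_of_le_left (by simpa using hC n)
  · refine le_max_of_le_right ?_
    have h := kroneckerTerm_neg_succ 1 hq0 hb n
    simp only [kroneckerTerm, one_zpow, one_mul] at h
    rw [h, norm_mul, norm_mul, norm_neg, norm_pow]
    gcongr
    exact (mul_le_of_le_one_left (norm_nonneg _) (pow_le_one₀ (norm_nonneg _) hq.le)).trans (hC' n)

lemma summable_appellSum {t : ℤ → ℂ} {q b : ℂ} (hq0 : q ≠ 0) (hq : ‖q‖ < 1) (hb : b ≠ 0)
    (ht : Summable t) : Summable (fun j : ℤ => t j * (1 - b⁻¹ * q ^ j)⁻¹) := by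
  obtain ⟨C, hC⟩ := exists_norm_inv_one_sub_mul_zpow_le hq0 hq hb
  refine Summable.of_norm_bounded (ht.norm.mul_right C) fun j => ?_
  rw [norm_mul]
  gcongr
  exact hC j

lemma appellSum_mul {t : ℤ → ℂ} {q b : ℂ} (hq0 : q ≠ 0) (hq : ‖q‖ < 1) (hb : b ≠ 0)
    (hbq : ∀ j : ℤ, b ≠ q ^ j) (ht : Summable t) (ht0 : ∑' j, t j = 0)
    (hrec : ∀ j, t (j + 1) = -q ^ (j + 1) * t j) :
    appellSum t q (b * q) = -(b * q) * appellSum t q b := by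
  have hterm : ∀ j : ℤ, t (j + 1) * (1 - (b * q)⁻¹ * q ^ (j + 1))⁻¹ =
      b * q * t j + -(b * q) * (t j * (1 - b⁻¹ * q ^ j)⁻¹) := by
    intro j
    have h1 : b - q ^ j ≠ 0 := sub_ne_zero.2 (hbq j)
    have h2 : (1 - b⁻¹ * q ^ j)⁻¹ = b * (b - q ^ j)⁻¹ := by
      rw [← inv_inj, inv_inv, mul_inv, inv_inv]; field_simp
    have h3 : (b * q)⁻¹ * q ^ (j + 1) = b⁻¹ * q ^ j := by
      rw [zpow_add_one₀ hq0]; field_simp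
    rw [h3, h2, hrec, zpow_add_one₀ hq0]
    field_simp
    ring
  rw [appellSum, ← (Equiv.addRight (1 : ℤ)).tsum_eq]
  simp only [Equiv.coe_addRight]
  rw [tsum_congr hterm, Summable.tsum_add (ht.mul_left _)
    ((summable_appellSum hq0 hq hb ht).mul_left _), tsum_mul_left, tsum_mul_left, ht0, appellSum]
  ring

lemma appellSum_mul_zpow {t : ℤ → ℂ} {q b : ℂ} (hq0 : q ≠ 0) (hq : ‖q‖ < 1) (hb : b ≠ 0)
    (hbq : ∀ j : ℤ, b ≠ q ^ j) (ht : Summable t) (ht0 : ∑' j, t j = 0)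
    (hrec : ∀ j, t (j + 1) = -q ^ (j + 1) * t j) (ht1 : t 0 = 1) (m : ℤ) :
    appellSum t q (b * q ^ m) = t m * b ^ m * appellSum t q b := by
  have step : ∀ m : ℤ, appellSum t q (b * q ^ (m + 1)) =
      -(b * q ^ (m + 1)) * appellSum t q (b * q ^ m) := by
    intro m
    have h := appellSum_mul (b := b * q ^ m) hq0 hq (by positivity) (fun j h => hbq (j - m) ?_)
      ht ht0 hrec
    · rwa [mul_assoc, ← zpow_add_one₀ hq0] at h
    · rw [zpow_sub₀ hq0, ← h]; field_simp
  induction m using Int.induction_on with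
  | zero => simp [ht1]
  | succ m ih => rw [step, ih, hrec, zpow_add_one₀ hb]; ring
  | pred m ih =>
    have h := step (-m - 1)
    have h2 := hrec (-m - 1)
    have h3 := zpow_add_one₀ hb (-(m : ℤ) - 1)
    rw [sub_add_cancel] at h h2 h3
    have h4 : -(b * q ^ (-(m : ℤ))) ≠ 0 := neg_ne_zero.2 (by positivity)
    apply mul_left_cancel₀ h4
    rw [← h, ih, h2, h3]
    ring

lemma tsum_kroneckerTerm_mul {t : ℤ → ℂ} {q a y : ℂ} (hq0 : q ≠ 0) (hq : ‖q‖ < 1) (ha : a ≠ 0)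
    (haq : ∀ j : ℤ, a ≠ q ^ j) (hy : 1 < ‖y‖) (hyq : ‖y * q‖ < 1)
    (ht : Summable t) (hty : Summable fun j => t j * y ^ j) (ht0 : ∑' j, t j = 0)
    (hrec : ∀ j, t (j + 1) = -q ^ (j + 1) * t j) (ht1 : t 0 = 1) :
    (∑' n, kroneckerTerm q a y n) * ∑' j, t j * y ^ j =
      (∑' m, t m * (a * y) ^ m) * appellSum t q a := by
  have hy0 : y ≠ 0 := norm_pos_iff.1 (one_pos.trans hy)
  have hK := summable_norm_kroneckerTerm hq0 hq ha hy hyq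
  let e : ℤ × ℤ ≃ ℤ × ℤ :=
    { toFun p := (p.2 - p.1, p.2)
      invFun p := (p.2 - p.1, p.2)
      left_inv p := by simp
      right_inv p := by simp }
  have hs := summable_mul_of_summable_norm hK hty.norm
  rw [tsum_mul_tsum_of_summable_norm hK hty.norm, ← e.tsum_eq, Summable.tsum_prod,
    ← tsum_mul_right]
  · refine tsum_congr fun m => ?_
    have h : ∀ j : ℤ, kroneckerTerm q a y (e (m, j)).1 * (t (e (m, j)).2 * y ^ (e (m, j)).2) =
        y ^ m * (t j * (1 - (a * q ^ m)⁻¹ * q ^ j)⁻¹) := by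
      intro j
      simp only [e, Equiv.coe_fn_mk, kroneckerTerm]
      rw [neg_sub, mul_inv, mul_assoc a⁻¹, ← zpow_neg, ← zpow_add₀ hq0, neg_add_eq_sub,
        zpow_sub₀ hy0]
      field_simp
    rw [tsum_congr h, tsum_mul_left, ← appellSum, appellSum_mul_zpow hq0 hq ha haq ht ht0 hrec ht1,
      mul_zpow]
    ring
  · exact e.summable_iff.2 hs

lemma one_sub_sqrt_le_norm_one_sub_mul_zpow {q c : ℂ} (hq0 : q ≠ 0) (hq : ‖q‖ < 1)
    (hc1 : √‖q‖ < ‖c‖) (hc2 : ‖c‖ * √‖q‖ < 1) {j : ℤ} (hj : j ≠ 0) :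
    1 - √‖q‖ ≤ ‖1 - c * q ^ j‖ := by
  have hq' : 0 < ‖q‖ := norm_pos_iff.2 hq0
  have hs0 : 0 < √‖q‖ := Real.sqrt_pos.2 hq'
  have hsq : √‖q‖ * √‖q‖ = ‖q‖ := Real.mul_self_sqrt hq'.le
  have hs1 : √‖q‖ < 1 := by nlinarith
  rcases lt_or_gt_of_ne hj with h | h
  · have h1 : 1 ≤ ‖q‖ * ‖q‖ ^ j := by
      rw [← zpow_one_add₀ hq'.ne']
      exact one_le_zpow_of_nonpos₀ hq' hq.le (by lia)
    have h2 : 1 ≤ √‖q‖ * (‖c‖ * ‖q‖ ^ j) := by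
      have : 0 < ‖q‖ ^ j := zpow_pos hq' j
      nlinarith [mul_le_mul_of_nonneg_right (mul_le_mul_of_nonneg_left hc1.le hs0.le) this.le]
    have h3 := norm_sub_norm_le (c * q ^ j) 1
    rw [norm_sub_rev, norm_one, norm_mul, norm_zpow] at h3
    nlinarith
  · have h1 : ‖q‖ ^ j ≤ ‖q‖ := by
      simpa using zpow_le_zpow_right_of_le_one₀ hq' hq.le (show (1 : ℤ) ≤ j by lia)
    have h2 := norm_sub_norm_le 1 (c * q ^ j)
    rw [norm_one, norm_mul, norm_zpow] at h2
    have h3 : ‖c‖ * ‖q‖ ^ j ≤ √‖q‖ := by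
      refine (mul_le_mul_of_nonneg_left h1 (norm_nonneg c)).trans ?_
      nlinarith
    linarith

lemma ne_zero_of_norm_eq_one {a : ℂ} (ha : ‖a‖ = 1) : a ≠ 0 := by
  rintro rfl; simp at ha

/-- Termwise limit of `f · appellSum` as the argument tends to a point of the unit circle, where
the term `j = 0` may be singular. -/
lemma tendsto_mul_appellSum {ι : Type*} {l : Filter ι} {t : ℤ → ℂ} {q : ℂ} {f A : ι → ℂ}
    {f0 A0 g0 : ℂ} (hq0 : q ≠ 0) (hq : ‖q‖ < 1) (ht : Summable t) (hA0 : ‖A0‖ = 1)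
    (hA : Tendsto A l (𝓝 A0)) (hf : Tendsto f l (𝓝 f0))
    (hg : Tendsto (fun i => f i * (1 - (A i)⁻¹)⁻¹) l (𝓝 g0)) :
    Tendsto (fun i => f i * appellSum t q (A i)) l
      (𝓝 (∑' j : ℤ, t j * if j = 0 then g0 else f0 * (1 - A0⁻¹ * q ^ j)⁻¹)) := by
  have hq' : 0 < ‖q‖ := norm_pos_iff.2 hq0
  have hs0 : 0 < √‖q‖ := Real.sqrt_pos.2 hq'
  have hs1 : √‖q‖ < 1 := by nlinarith [Real.mul_self_sqrt hq'.le]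
  have hAinv : Tendsto (fun i => (A i)⁻¹) l (𝓝 A0⁻¹) := hA.inv₀ (ne_zero_of_norm_eq_one hA0)
  have hn0 : ‖A0⁻¹‖ = 1 := by rw [norm_inv, hA0, inv_one]
  simp_rw [appellSum, ← tsum_mul_left]
  refine tendsto_tsum_of_dominated_convergence
    (bound := fun j => ‖t j‖ * max (‖g0‖ + 1) ((‖f0‖ + 1) * (1 - √‖q‖)⁻¹))
    (ht.norm.mul_right _) (fun j => ?_) ?_
  · split_ifs with hj
    · subst hj
      simpa [mul_left_comm] using hg.const_mul (t 0)
    · have hne : 1 - A0⁻¹ * q ^ j ≠ 0 := by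
        rw [← norm_pos_iff]
        have := one_sub_sqrt_le_norm_one_sub_mul_zpow (c := A0⁻¹) hq0 hq (by rwa [hn0])
          (by rwa [hn0, one_mul]) hj
        linarith
      simpa only [mul_left_comm] using
        (hf.mul (((hAinv.mul_const (q ^ j)).const_sub 1).inv₀ hne)).const_mul (t j)
  · filter_upwards [hAinv.norm.eventually_const_lt (u := √‖q‖) (by rwa [hn0]),
      (hAinv.norm.mul_const √‖q‖).eventually_lt_const (u := 1) (by rwa [hn0, one_mul]),
      hf.norm.eventually_le_const (lt_add_one _), hg.norm.eventually_le_const (lt_add_one _)]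
      with i h1 h2 h3 h4 j
    rw [mul_left_comm, norm_mul]
    refine mul_le_mul_of_nonneg_left ?_ (norm_nonneg _)
    by_cases hj : j = 0
    · subst hj
      exact le_max_of_le_left (by simpa using h4)
    · refine le_max_of_le_right ?_
      rw [norm_mul, norm_inv]
      refine mul_le_mul h3 (inv_anti₀ (by linarith) ?_) (by positivity) (by positivity)
      exact one_sub_sqrt_le_norm_one_sub_mul_zpow hq0 hq h1 h2 hj

lemma ne_zpow_of_norm {q a : ℂ} (hq0 : q ≠ 0) (hq : ‖q‖ < 1) (ha : 1 < ‖a‖)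
    (haq : ‖a * q‖ < 1) (j : ℤ) : a ≠ q ^ j := by
  have hq' : 0 < ‖q‖ := norm_pos_iff.2 hq0
  rintro rfl
  rw [← zpow_add_one₀ hq0, norm_zpow, zpow_lt_one_iff_right_of_lt_one₀ hq' hq] at haq
  rw [norm_zpow, one_lt_zpow_iff_right_of_lt_one₀ hq' hq] at ha
  lia

/-- The function `e(x) = exp(2πix)`. -/
noncomputable def expTwoPiI (x : ℂ) : ℂ := Complex.exp (2 * Real.pi * I * x)

lemma expTwoPiI_ne_zero (x : ℂ) : expTwoPiI x ≠ 0 := Complex.exp_ne_zero _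

lemma expTwoPiI_add (x y : ℂ) : expTwoPiI (x + y) = expTwoPiI x * expTwoPiI y := by
  rw [expTwoPiI, mul_add, Complex.exp_add]; rfl

lemma expTwoPiI_zpow (x : ℂ) (n : ℤ) :
    expTwoPiI x ^ n = Complex.exp (n * (2 * Real.pi * I * x)) := (Complex.exp_int_mul _ _).symm

lemma norm_expTwoPiI (x : ℂ) : ‖expTwoPiI x‖ = Real.exp (-(2 * Real.pi * x.im)) := by
  rw [expTwoPiI, Complex.norm_exp]
  simp

lemma norm_expTwoPiI_lt_one {τ : ℂ} (hτ : 0 < τ.im) : ‖expTwoPiI τ‖ < 1 := by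
  rw [norm_expTwoPiI, Real.exp_lt_one_iff]
  have := Real.pi_pos
  simp only [Left.neg_neg_iff]
  positivity

lemma one_lt_norm_expTwoPiI {x : ℂ} (hx : x.im < 0) : 1 < ‖expTwoPiI x‖ := by
  rw [norm_expTwoPiI, Real.one_lt_exp_iff]
  nlinarith [Real.pi_pos]

lemma norm_expTwoPiI_mul_lt_one {x τ : ℂ} (hx : -τ.im < x.im) :
    ‖expTwoPiI x * expTwoPiI τ‖ < 1 := by
  rw [← expTwoPiI_add]
  exact norm_expTwoPiI_lt_one (by rw [add_im]; linarith)

lemma continuous_expTwoPiI : Continuous expTwoPiI := by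
  unfold expTwoPiI; fun_prop

/-- The Fourier coefficients of `θ₁`, up to normalization. -/
noncomputable def thetaCoeff (τ : ℂ) (j : ℤ) : ℂ := jacobiTheta₂_term j (1 / 2 + τ / 2) τ

/-- The theta function `θ₁` without its exponential prefactor. -/
noncomputable def reducedTheta (x τ : ℂ) : ℂ := jacobiTheta₂ (x + (1 / 2 + τ / 2)) τ

lemma thetaCoeff_mul_zpow (x τ : ℂ) (j : ℤ) :
    thetaCoeff τ j * expTwoPiI x ^ j = jacobiTheta₂_term j (x + (1 / 2 + τ / 2)) τ := by
  rw [expTwoPiI_zpow, thetaCoeff, jacobiTheta₂_term, jacobiTheta₂_term, ← Complex.exp_add]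
  ring_nf

lemma reducedTheta_eq_tsum (x τ : ℂ) :
    reducedTheta x τ = ∑' j, thetaCoeff τ j * expTwoPiI x ^ j := by
  simp_rw [thetaCoeff_mul_zpow]; rfl

lemma summable_thetaCoeff_mul_zpow {τ : ℂ} (hτ : 0 < τ.im) (x : ℂ) :
    Summable fun j => thetaCoeff τ j * expTwoPiI x ^ j := by
  simp_rw [thetaCoeff_mul_zpow]
  exact (summable_jacobiTheta₂_term_iff _ _).2 hτ

lemma summable_thetaCoeff {τ : ℂ} (hτ : 0 < τ.im) : Summable (thetaCoeff τ) :=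
  (summable_jacobiTheta₂_term_iff _ _).2 hτ

lemma thetaCoeff_zero (τ : ℂ) : thetaCoeff τ 0 = 1 := by
  simp [thetaCoeff, jacobiTheta₂_term]

lemma thetaCoeff_add_one (τ : ℂ) (j : ℤ) :
    thetaCoeff τ (j + 1) = -expTwoPiI τ ^ (j + 1) * thetaCoeff τ j := by
  rw [expTwoPiI_zpow, thetaCoeff, thetaCoeff, jacobiTheta₂_term, jacobiTheta₂_term,
    neg_mul, ← Complex.exp_add, ← neg_one_mul, ← Complex.exp_pi_mul_I, ← Complex.exp_add]
  push_cast
  ring_nf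

lemma reducedTheta_add_tau (x τ : ℂ) :
    reducedTheta (x + τ) τ = -(expTwoPiI x * expTwoPiI τ)⁻¹ * reducedTheta x τ := by
  have h : x + τ + (1 / 2 + τ / 2) = x + (1 / 2 + τ / 2) + τ := by ring
  rw [reducedTheta, h, jacobiTheta₂_add_left', reducedTheta, ← expTwoPiI_add, expTwoPiI,
    ← Complex.exp_neg, ← neg_one_mul (Complex.exp _), ← Complex.exp_neg_pi_mul_I,
    ← Complex.exp_add]
  ring_nf

lemma reducedTheta_zero (τ : ℂ) : reducedTheta 0 τ = 0 := by
  have h := reducedTheta_add_tau (-τ) τ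
  have h1 : reducedTheta (-τ) τ = reducedTheta 0 τ := by
    rw [reducedTheta, ← jacobiTheta₂_neg_left, ← jacobiTheta₂_add_left, reducedTheta]
    ring_nf
  rw [neg_add_cancel, h1, ← expTwoPiI_add, neg_add_cancel, expTwoPiI, mul_zero,
    Complex.exp_zero] at h
  linear_combination h / 2

lemma differentiable_reducedTheta {τ : ℂ} (hτ : 0 < τ.im) :
    Differentiable ℂ fun x => reducedTheta x τ := fun x =>
  (differentiableAt_jacobiTheta₂_fst _ hτ).comp x (differentiableAt_id.add_const _)

lemma tsum_thetaCoeff (τ : ℂ) : ∑' j, thetaCoeff τ j = 0 := by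
  simpa [expTwoPiI, reducedTheta_zero] using (reducedTheta_eq_tsum 0 τ).symm

lemma theta1_eq_reducedTheta (x τ : ℂ) :
    theta1 x τ = -Complex.exp (Real.pi * I * τ / 4 + Real.pi * I / 2) *
      Complex.exp (Real.pi * I * x) * reducedTheta x τ := by
  rw [theta1, reducedTheta, jacobiTheta₂, neg_mul, neg_mul, ← tsum_mul_left]
  congr 1
  refine tsum_congr fun j => ?_
  rw [jacobiTheta₂_term, ← Complex.exp_add, ← Complex.exp_add]
  ring_nf

lemma theta1Deriv_zero {τ : ℂ} (hτ : 0 < τ.im) :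
    theta1Deriv 0 τ = -Complex.exp (Real.pi * I * τ / 4 + Real.pi * I / 2) *
      deriv (fun x => reducedTheta x τ) 0 := by
  have h1 : DifferentiableAt ℂ (fun x : ℂ => -Complex.exp (Real.pi * I * τ / 4 + Real.pi * I / 2) *
      Complex.exp (Real.pi * I * x)) 0 := by fun_prop
  simp_rw [theta1Deriv, theta1_eq_reducedTheta]
  rw [deriv_fun_mul h1 (differentiable_reducedTheta hτ 0), reducedTheta_zero]
  simp

/-- The product of `θ₁` and the Appell sum, which turns out to be constant. -/
noncomputable def thetaAppell (x τ : ℂ) : ℂ :=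
  reducedTheta x τ * appellSum (thetaCoeff τ) (expTwoPiI τ) (expTwoPiI x)

lemma tsum_kroneckerTerm_mul_reducedTheta {τ x z : ℂ} (hτ : 0 < τ.im)
    (hx : ∀ j : ℤ, expTwoPiI x ≠ expTwoPiI τ ^ j) (hz1 : -τ.im < z.im) (hz2 : z.im < 0) :
    (∑' n, kroneckerTerm (expTwoPiI τ) (expTwoPiI x) (expTwoPiI z) n) * reducedTheta z τ =
      reducedTheta (x + z) τ * appellSum (thetaCoeff τ) (expTwoPiI τ) (expTwoPiI x) := by
  rw [reducedTheta_eq_tsum, reducedTheta_eq_tsum, expTwoPiI_add]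
  exact tsum_kroneckerTerm_mul (expTwoPiI_ne_zero τ) (norm_expTwoPiI_lt_one hτ)
    (expTwoPiI_ne_zero x) hx (one_lt_norm_expTwoPiI hz2) (norm_expTwoPiI_mul_lt_one hz1)
    (summable_thetaCoeff hτ) (summable_thetaCoeff_mul_zpow hτ z) (tsum_thetaCoeff τ)
    (thetaCoeff_add_one τ) (thetaCoeff_zero τ)

lemma expTwoPiI_ne_zpow_of_im {τ x : ℂ} (hτ : 0 < τ.im) (hx1 : -τ.im < x.im) (hx2 : x.im < 0)
    (j : ℤ) : expTwoPiI x ≠ expTwoPiI τ ^ j :=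
  ne_zpow_of_norm (expTwoPiI_ne_zero τ) (norm_expTwoPiI_lt_one hτ) (one_lt_norm_expTwoPiI hx2)
    (norm_expTwoPiI_mul_lt_one hx1) j

lemma thetaAppell_mul_reducedTheta_comm {τ x z : ℂ} (hτ : 0 < τ.im)
    (hx1 : -τ.im < x.im) (hx2 : x.im < 0) (hz1 : -τ.im < z.im) (hz2 : z.im < 0) :
    thetaAppell x τ * reducedTheta (x + z) τ = thetaAppell z τ * reducedTheta (x + z) τ := by
  have h1 := tsum_kroneckerTerm_mul_reducedTheta hτ (expTwoPiI_ne_zpow_of_im hτ hx1 hx2) hz1 hz2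
  have h2 := tsum_kroneckerTerm_mul_reducedTheta hτ (expTwoPiI_ne_zpow_of_im hτ hz1 hz2) hx1 hx2
  rw [tsum_kroneckerTerm_comm (expTwoPiI_ne_zero τ) (norm_expTwoPiI_lt_one hτ)
    (one_lt_norm_expTwoPiI hz2) (norm_expTwoPiI_mul_lt_one hz1) (one_lt_norm_expTwoPiI hx2)
    (norm_expTwoPiI_mul_lt_one hx1), add_comm] at h2
  rw [thetaAppell, thetaAppell]
  linear_combination reducedTheta z τ * h2 - reducedTheta x τ * h1

lemma tendsto_real_sub_mul_I (r : ℝ) :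
    Tendsto (fun ε : ℝ => (r : ℂ) - ε * I) (𝓝[>] 0) (𝓝 r) := by
  have h : Continuous fun ε : ℝ => (r : ℂ) - ε * I := by fun_prop
  simpa using (h.tendsto 0).mono_left nhdsWithin_le_nhds

lemma eventually_mem_strip {τ : ℂ} (hτ : 0 < τ.im) (r : ℝ) :
    ∀ᶠ ε : ℝ in 𝓝[>] 0, -τ.im < ((r : ℂ) - ε * I).im ∧ ((r : ℂ) - ε * I).im < 0 := by
  filter_upwards [Ioo_mem_nhdsGT hτ] with ε hε
  simpa using ⟨hε.2, hε.1⟩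

lemma norm_expTwoPiI_ofReal (r : ℝ) : ‖expTwoPiI r‖ = 1 := by
  simp [norm_expTwoPiI]

lemma tendsto_thetaAppell_zero {τ : ℂ} (hτ : 0 < τ.im) :
    Tendsto (fun ε : ℝ => thetaAppell (-(ε * I)) τ) (𝓝[>] 0)
      (𝓝 (deriv (fun x => reducedTheta x τ) 0 / (2 * Real.pi * I))) := by
  have hx : Tendsto (fun ε : ℝ => -((ε : ℂ) * I)) (𝓝[>] 0) (𝓝[≠] 0) := by
    refine tendsto_nhdsWithin_iff.2 ⟨by simpa using tendsto_real_sub_mul_I 0, ?_⟩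
    filter_upwards [self_mem_nhdsWithin] with ε hε
    simpa using (Set.mem_Ioi.1 hε).ne'
  have hd : HasDerivAt (fun x => 1 - (expTwoPiI x)⁻¹) (2 * Real.pi * I) 0 := by
    have h : HasDerivAt (fun x => 1 - Complex.exp (-(2 * Real.pi * I * x)))
        (-(Complex.exp (-(2 * Real.pi * I * 0)) * -(2 * Real.pi * I * 1))) 0 :=
      (((hasDerivAt_id (0 : ℂ)).const_mul _).neg.cexp).const_sub 1
    simpa [expTwoPiI, Complex.exp_neg] using h
  have hdiff := differentiable_reducedTheta hτ
  have hg := ((hdiff 0).hasDerivAt.tendsto_slope.div hd.tendsto_slope Complex.two_pi_I_ne_zero)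
  have hg' : Tendsto (fun x => reducedTheta x τ * (1 - (expTwoPiI x)⁻¹)⁻¹) (𝓝[≠] 0)
      (𝓝 (deriv (fun x => reducedTheta x τ) 0 / (2 * Real.pi * I))) := by
    refine hg.congr' ?_
    filter_upwards [self_mem_nhdsWithin] with x hx
    have hx : x ≠ 0 := hx
    simp only [Pi.div_apply, slope_def_field, reducedTheta_zero, sub_zero]
    rw [div_div_div_cancel_right₀ hx]
    simp [expTwoPiI, div_eq_mul_inv]
  have hlim := tendsto_mul_appellSum (A0 := 1) (f0 := 0) (expTwoPiI_ne_zero τ)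
    (norm_expTwoPiI_lt_one hτ) (summable_thetaCoeff hτ) norm_one
    (A := fun ε : ℝ => expTwoPiI (-(ε * I))) (f := fun ε : ℝ => reducedTheta (-(ε * I)) τ)
    (l := 𝓝[>] 0) ?_ ?_ (hg'.comp hx)
  · simpa [thetaAppell, thetaCoeff_zero] using hlim
  · have h := continuous_expTwoPiI.tendsto 0
    simp only [expTwoPiI, mul_zero, Complex.exp_zero] at h
    exact h.comp (hx.mono_right nhdsWithin_le_nhds)
  · have h := hdiff.continuous.tendsto 0
    rw [reducedTheta_zero] at h
    exact h.comp (hx.mono_right nhdsWithin_le_nhds)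

lemma thetaAppell_eq_of_mem_strip {τ z : ℂ} (hτ : 0 < τ.im) (hz1 : -τ.im < z.im)
    (hz2 : z.im < 0) (hθ : reducedTheta z τ ≠ 0) :
    thetaAppell z τ = deriv (fun x => reducedTheta x τ) 0 / (2 * Real.pi * I) := by
  have hc : Tendsto (fun ε : ℝ => reducedTheta (-(ε * I) + z) τ) (𝓝[>] 0)
      (𝓝 (reducedTheta z τ)) := by
    have h : Continuous fun ε : ℝ => reducedTheta (-(ε * I) + z) τ :=
      (differentiable_reducedTheta hτ).continuous.comp (by fun_prop)
    simpa using (h.tendsto 0).mono_left nhdsWithin_le_nhds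
  refine mul_right_cancel₀ hθ (tendsto_nhds_unique (hc.const_mul _) ?_)
  refine ((tendsto_thetaAppell_zero hτ).mul hc).congr' ?_
  filter_upwards [eventually_mem_strip hτ 0] with ε hε
  rw [ofReal_zero, zero_sub] at hε
  exact thetaAppell_mul_reducedTheta_comm hτ hε.1 hε.2 hz1 hz2

lemma thetaAppell_ofReal {τ : ℂ} {r : ℝ} (hτ : 0 < τ.im) (hr : expTwoPiI r ≠ 1)
    (hθ : reducedTheta r τ ≠ 0) :
    thetaAppell r τ = deriv (fun x => reducedTheta x τ) 0 / (2 * Real.pi * I) := by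
  have hx := tendsto_real_sub_mul_I r
  have hf := ((differentiable_reducedTheta hτ).continuous.tendsto _).comp hx
  have hA := (continuous_expTwoPiI.tendsto _).comp hx
  have hne : 1 - (expTwoPiI r)⁻¹ ≠ 0 := by
    rw [sub_ne_zero, ne_comm, Ne, inv_eq_one]; exact hr
  have hlim := tendsto_mul_appellSum (expTwoPiI_ne_zero τ) (norm_expTwoPiI_lt_one hτ)
    (summable_thetaCoeff hτ) (norm_expTwoPiI_ofReal r) hA hf
    (hf.mul (((hA.inv₀ (expTwoPiI_ne_zero _)).const_sub 1).inv₀ hne))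
  have heq : thetaAppell r τ = ∑' j : ℤ, thetaCoeff τ j * if j = 0 then
      reducedTheta r τ * (1 - (expTwoPiI r)⁻¹)⁻¹ else
      reducedTheta r τ * (1 - (expTwoPiI r)⁻¹ * expTwoPiI τ ^ j)⁻¹ := by
    rw [thetaAppell, appellSum, ← tsum_mul_left]
    refine tsum_congr fun j => ?_
    split_ifs with hj
    · simp [hj, mul_left_comm]
    · ring
  rw [heq]
  refine tendsto_nhds_unique hlim (tendsto_const_nhds.congr' ?_)
  filter_upwards [eventually_mem_strip hτ r, hf.eventually_ne hθ] with ε hε h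
  exact (thetaAppell_eq_of_mem_strip hτ hε.1 hε.2 h).symm

lemma thetaAppell_add_tau {τ x : ℂ} (hτ : 0 < τ.im)
    (hx : ∀ j : ℤ, expTwoPiI x ≠ expTwoPiI τ ^ j) : thetaAppell (x + τ) τ = thetaAppell x τ := by
  rw [thetaAppell, reducedTheta_add_tau, expTwoPiI_add, appellSum_mul (expTwoPiI_ne_zero τ)
    (norm_expTwoPiI_lt_one hτ) (expTwoPiI_ne_zero x) hx (summable_thetaCoeff hτ)
    (tsum_thetaCoeff τ) (thetaCoeff_add_one τ), thetaAppell]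
  have := expTwoPiI_ne_zero x
  have := expTwoPiI_ne_zero τ
  field_simp

lemma expTwoPiI_add_int_mul_ne_zpow {τ x : ℂ} (hx : ∀ j : ℤ, expTwoPiI x ≠ expTwoPiI τ ^ j)
    (n j : ℤ) : expTwoPiI (x + n * τ) ≠ expTwoPiI τ ^ j := by
  intro h
  apply hx (j - n)
  rw [zpow_sub₀ (expTwoPiI_ne_zero τ), ← h, expTwoPiI_add, expTwoPiI_zpow]
  rw [show expTwoPiI (n * τ) = Complex.exp (n * (2 * Real.pi * I * τ)) by
    rw [expTwoPiI, mul_left_comm], mul_div_cancel_right₀ _ (Complex.exp_ne_zero _)]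

lemma thetaAppell_add_int_mul {τ x : ℂ} (hτ : 0 < τ.im)
    (hx : ∀ j : ℤ, expTwoPiI x ≠ expTwoPiI τ ^ j) (n : ℤ) :
    thetaAppell (x + n * τ) τ = thetaAppell x τ := by
  induction n using Int.induction_on with
  | zero => simp
  | succ n ih =>
    rw [← ih, ← thetaAppell_add_tau hτ (expTwoPiI_add_int_mul_ne_zpow hx n)]
    push_cast; ring_nf
  | pred n ih =>
    rw [← ih, ← thetaAppell_add_tau hτ (expTwoPiI_add_int_mul_ne_zpow hx _)]
    push_cast; ring_nf

lemma reducedTheta_add_int_mul_ne_zero {τ x : ℂ} (hx : reducedTheta x τ ≠ 0) (n : ℤ) :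
    reducedTheta (x + n * τ) τ ≠ 0 := by
  have step : ∀ x, reducedTheta (x + τ) τ ≠ 0 ↔ reducedTheta x τ ≠ 0 := fun x => by
    rw [reducedTheta_add_tau]
    simp [expTwoPiI_ne_zero]
  induction n using Int.induction_on with
  | zero => simpa
  | succ n ih =>
    rw [← step] at ih
    convert ih using 2
    push_cast; ring
  | pred n ih =>
    rw [← step]
    convert ih using 2
    push_cast; ring

lemma thetaAppell_eq {τ x : ℂ} (hτ : 0 < τ.im)
    (hx : ∀ j : ℤ, expTwoPiI x ≠ expTwoPiI τ ^ j) (hθ : reducedTheta x τ ≠ 0) :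
    thetaAppell x τ = deriv (fun x => reducedTheta x τ) 0 / (2 * Real.pi * I) := by
  set n : ℤ := -⌈x.im / τ.im⌉ with hn
  have hθ' := reducedTheta_add_int_mul_ne_zero hθ n
  have hx' := expTwoPiI_add_int_mul_ne_zpow hx n
  rw [← thetaAppell_add_int_mul hτ hx n]
  have him : (x + n * τ).im = x.im + n * τ.im := by simp
  have h1 : -τ.im < (x + n * τ).im := by
    have := Int.ceil_lt_add_one (x.im / τ.im)
    rw [← sub_lt_iff_lt_add, lt_div_iff₀ hτ] at this
    rw [him, hn]; push_cast; linarith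
  have h2 : (x + n * τ).im ≤ 0 := by
    have := Int.le_ceil (x.im / τ.im)
    rw [div_le_iff₀ hτ] at this
    rw [him, hn]; push_cast; linarith
  rcases h2.lt_or_eq with h2 | h2
  · exact thetaAppell_eq_of_mem_strip hτ h1 h2 hθ'
  · obtain ⟨r, hr⟩ : ∃ r : ℝ, x + n * τ = r :=
      ⟨(x + n * τ).re, Complex.ext (by simp) (by simpa using h2)⟩
    rw [hr] at hθ' hx' ⊢
    exact thetaAppell_ofReal hτ (by simpa using hx' 0) hθ'

lemma one_add_coth_div_two {u : ℂ} (hu : Complex.sinh u ≠ 0) :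
    (1 / 2 : ℂ) * (1 + coth u) = (1 - Complex.exp (-(2 * u)))⁻¹ := by
  have h1 : 2 * Complex.sinh u * Complex.exp (-u) = 1 - Complex.exp (-(2 * u)) := by
    rw [Complex.two_sinh, sub_mul, ← Complex.exp_add, ← Complex.exp_add]
    ring_nf
    simp
  have h2 : Complex.cosh u + Complex.sinh u = Complex.exp u := Complex.cosh_add_sinh u
  rw [← h1, coth, mul_inv, ← Complex.exp_neg, neg_neg, ← h2]
  field_simp
  ring

lemma sinh_ne_zero {u : ℂ} (hu : ∀ m : ℤ, u ≠ Real.pi * I * m) : Complex.sinh u ≠ 0 := by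
  intro h
  have h1 : Complex.exp (2 * u) = 1 := by
    have h2 := Complex.two_sinh u
    rw [h, mul_zero, eq_comm, sub_eq_zero] at h2
    rw [two_mul, Complex.exp_add]
    nth_rewrite 2 [h2]
    rw [← Complex.exp_add, add_neg_cancel, Complex.exp_zero]
  obtain ⟨m, hm⟩ := Complex.exp_eq_one_iff.1 h1
  exact hu m (by linear_combination hm / 2)

/-- For `Im τ > 0`, `−Im τ < Im z < 0`, `w/2 + πiτn ∉ πiℤ` for all `n ∈ ℤ`,
`θ₁(z|τ) ≠ 0` and `θ₁(w/(2πi)|τ) ≠ 0`, the family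
`n ↦ (1/2)·e^{2πizn}·(1 + coth(w/2 + πiτn))` is absolutely summable and its sum is
`χ(w,z|τ)`. -/
theorem chi_series (τ w z : ℂ) (hτ : 0 < τ.im)
    (hz1 : -τ.im < z.im) (hz2 : z.im < 0)
    (hw : ∀ n m : ℤ, w / 2 + (Real.pi : ℂ) * I * τ * (n : ℂ) ≠ (Real.pi : ℂ) * I * (m : ℂ))
    (hθz : theta1 z τ ≠ 0)
    (hθw : theta1 (w / (2 * (Real.pi : ℂ) * I)) τ ≠ 0) :
    Summable (fun n : ℤ => ‖(1 / 2 : ℂ) * Complex.exp (2 * (Real.pi : ℂ) * I * z * (n : ℂ)) *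
        (1 + coth (w / 2 + (Real.pi : ℂ) * I * τ * (n : ℂ)))‖) ∧
    ∑' n : ℤ, (1 / 2 : ℂ) * Complex.exp (2 * (Real.pi : ℂ) * I * z * (n : ℂ)) *
        (1 + coth (w / 2 + (Real.pi : ℂ) * I * τ * (n : ℂ))) = chi w z τ := by
  set x : ℂ := w / (2 * Real.pi * I) with hxdef
  have hxw : 2 * Real.pi * I * x = w := mul_div_cancel₀ _ Complex.two_pi_I_ne_zero
  have hx : ∀ j : ℤ, expTwoPiI x ≠ expTwoPiI τ ^ j := by
    intro j h
    rw [expTwoPiI_zpow, expTwoPiI, hxw, Complex.exp_eq_exp_iff_exists_int] at h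
    obtain ⟨m, hm⟩ := h
    refine hw (-j) m ?_
    push_cast
    linear_combination hm / 2
  have hterm : ∀ n : ℤ, (1 / 2 : ℂ) * Complex.exp (2 * (Real.pi : ℂ) * I * z * (n : ℂ)) *
      (1 + coth (w / 2 + (Real.pi : ℂ) * I * τ * (n : ℂ))) =
      kroneckerTerm (expTwoPiI τ) (expTwoPiI x) (expTwoPiI z) (Equiv.neg ℤ n) := by
    intro n
    rw [mul_right_comm, one_add_coth_div_two (sinh_ne_zero (hw n)), kroneckerTerm, Equiv.neg_apply,
      neg_neg, expTwoPiI_zpow, expTwoPiI_zpow, expTwoPiI, hxw, ← Complex.exp_neg,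
      ← Complex.exp_add, mul_comm]
    push_cast
    ring_nf
  simp_rw [hterm]
  rw [(Equiv.neg ℤ).tsum_eq]
  refine ⟨(Equiv.neg ℤ).summable_iff.2 (summable_norm_kroneckerTerm (expTwoPiI_ne_zero τ)
    (norm_expTwoPiI_lt_one hτ) (expTwoPiI_ne_zero x) (one_lt_norm_expTwoPiI hz2)
    (norm_expTwoPiI_mul_lt_one hz1)), ?_⟩
  rw [theta1_eq_reducedTheta] at hθz hθw
  have hz0 := right_ne_zero_of_mul hθz
  have hx0 := right_ne_zero_of_mul hθw
  have hprod := tsum_kroneckerTerm_mul_reducedTheta hτ hx hz1 hz2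
  have hconst := thetaAppell_eq hτ hx hx0
  rw [chi, ← hxdef, theta1_eq_reducedTheta, theta1_eq_reducedTheta, theta1_eq_reducedTheta,
    theta1Deriv_zero hτ]
  rw [thetaAppell] at hconst
  rw [eq_div_of_mul_eq hz0 hprod, eq_div_of_mul_eq hx0 ((mul_comm _ _).trans hconst)]
  field_simp
  rw [add_mul, add_mul, Complex.exp_add]
  ring
end

section
/- Let Im τ > 0 and set D := {(w,z) ∈ ℂ² : w/2 + πiτn ∉ πiℤ for all n ∈ ℤ, and −Im τ < Im z < 0}. Then the sequence of symmetric partial sums S_M(w,z) := (1/2)·∑_{n=−M}^{M} e^{2πizn}·(1 + coth(w/2 + πiτn)) converges, as M → ∞, uniformly on every compact subset of D (to the pointwise sum of the absolutely convergent series). -/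
open Complex

/-- Away from the poles, `(1 + coth u) / 2 = e^{2u} / (e^{2u} - 1)`. -/
theorem half_one_add_coth {u : ℂ} (h : Complex.exp (2 * u) ≠ 1) :
    (1 / 2 : ℂ) * (1 + coth u) = Complex.exp (2 * u) / (Complex.exp (2 * u) - 1) := by
  have h1 : Complex.exp (2 * u) = Complex.exp u * Complex.exp u := by
    rw [← Complex.exp_add]; ring_nf
  have h2 : Complex.exp (2 * u) - 1 ≠ 0 := sub_ne_zero.mpr h
  have h0 : Complex.exp u ≠ 0 := Complex.exp_ne_zero u
  have h3 : Complex.sinh u = (Complex.exp (2 * u) - 1) / (2 * Complex.exp u) := by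
    rw [Complex.sinh, Complex.exp_neg, h1]; field_simp
  have h4 : Complex.cosh u = (Complex.exp (2 * u) + 1) / (2 * Complex.exp u) := by
    rw [Complex.cosh, Complex.exp_neg, h1]; field_simp
  rw [coth, h3, h4]
  field_simp
  ring

theorem norm_exp_two_mul (u : ℂ) : ‖Complex.exp (2 * u)‖ = Real.exp (2 * u.re) := by
  simp [Complex.norm_exp]

theorem norm_half_one_add_coth_le_of_re_le {u : ℂ} (hu : 2 * u.re ≤ -1) :
    ‖(1 / 2 : ℂ) * (1 + coth u)‖ ≤ 2 * Real.exp (2 * u.re) := by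
  have hn := norm_exp_two_mul u
  have hs : Real.exp (2 * u.re) ≤ 1 / 2 := by
    have h1 : Real.exp (2 * u.re) * Real.exp (-(2 * u.re)) = 1 := by
      rw [← Real.exp_add]; simp
    nlinarith [Real.add_one_le_exp (-(2 * u.re)), Real.exp_pos (2 * u.re)]
  have hd : 1 / 2 ≤ ‖Complex.exp (2 * u) - 1‖ := by
    have := norm_sub_norm_le (1 : ℂ) (Complex.exp (2 * u))
    rw [norm_sub_rev, hn, norm_one] at this
    linarith
  have h : Complex.exp (2 * u) ≠ 1 := by
    intro h; norm_num [h] at hd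
  rw [half_one_add_coth h, norm_div, hn, div_le_iff₀ (by linarith)]
  nlinarith [Real.exp_pos (2 * u.re)]

theorem norm_half_one_add_coth_le_of_le_re {u : ℂ} (hu : 1 ≤ 2 * u.re) :
    ‖(1 / 2 : ℂ) * (1 + coth u)‖ ≤ 2 := by
  have hn := norm_exp_two_mul u
  have hs : 2 ≤ Real.exp (2 * u.re) := by linarith [Real.add_one_le_exp (2 * u.re)]
  have hd : Real.exp (2 * u.re) - 1 ≤ ‖Complex.exp (2 * u) - 1‖ := by
    have := norm_sub_norm_le (Complex.exp (2 * u)) (1 : ℂ)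
    rwa [hn, norm_one] at this
  have h : Complex.exp (2 * u) ≠ 1 := by
    intro h; norm_num [h] at hd; linarith
  rw [half_one_add_coth h, norm_div, hn, div_le_iff₀ (by linarith)]
  linarith

theorem summable_exp_neg_mul_abs_int {c : ℝ} (hc : 0 < c) :
    Summable fun n : ℤ => Real.exp (-c * |(n : ℝ)|) := by
  have h : Summable fun n : ℕ => Real.exp (-c * n) := by
    simpa [mul_comm] using Real.summable_exp_nat_mul_iff.mpr (neg_lt_zero.mpr hc)
  exact Summable.of_nat_of_neg (by simpa using h) (by simpa using h)

/-- Bound on the `n`-th term of the series once `|n|` is large. -/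
theorem norm_chi_series_term_le {τ w z : ℂ} {δ R : ℝ} (hR : |w.re| ≤ R)
    (hδ : δ ≤ -z.im) (hδ' : δ ≤ z.im + τ.im) {n : ℤ}
    (hn : R + 1 ≤ 2 * Real.pi * τ.im * |(n : ℝ)|) :
    ‖(1 / 2 : ℂ) * Complex.exp (2 * (Real.pi : ℂ) * I * z * (n : ℂ)) *
        (1 + coth (w / 2 + (Real.pi : ℂ) * I * τ * (n : ℂ)))‖ ≤
      2 * Real.exp R * Real.exp (-(2 * Real.pi * δ) * |(n : ℝ)|) := by
  have hre : 2 * (w / 2 + (Real.pi : ℂ) * I * τ * (n : ℂ)).re =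
      w.re - 2 * Real.pi * τ.im * n := by
    simp; ring
  have hexp : ‖Complex.exp (2 * (Real.pi : ℂ) * I * z * (n : ℂ))‖ =
      Real.exp (-(2 * Real.pi * z.im * n)) := by
    rw [Complex.norm_exp]; simp
  have hsplit : ∀ a b c : ℂ, a * b * c = b * (a * c) := fun a b c => by ring
  obtain ⟨hw1, hw2⟩ := abs_le.mp hR
  rw [hsplit, norm_mul, hexp]
  rcases le_total 0 (n : ℝ) with h0 | h0
  · rw [abs_of_nonneg h0] at hn ⊢
    have hb := norm_half_one_add_coth_le_of_re_le
      (u := w / 2 + (Real.pi : ℂ) * I * τ * (n : ℂ)) (by rw [hre]; linarith)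
    rw [hre] at hb
    calc _ ≤ Real.exp (-(2 * Real.pi * z.im * n)) *
          (2 * Real.exp (w.re - 2 * Real.pi * τ.im * n)) := by gcongr
      _ = 2 * Real.exp (w.re + -(2 * Real.pi * n * (z.im + τ.im))) := by
          rw [mul_left_comm, ← Real.exp_add]; ring_nf
      _ ≤ 2 * Real.exp (R + -(2 * Real.pi * n * δ)) := by gcongr
      _ = _ := by rw [Real.exp_add]; ring_nf
  · rw [abs_of_nonpos h0] at hn ⊢
    have hb := norm_half_one_add_coth_le_of_le_re
      (u := w / 2 + (Real.pi : ℂ) * I * τ * (n : ℂ)) (by rw [hre]; linarith)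
    calc _ ≤ Real.exp (-(2 * Real.pi * z.im * n)) * 2 := by gcongr
      _ = 2 * Real.exp (0 + -(2 * Real.pi * (-n) * (-z.im))) := by ring_nf
      _ ≤ 2 * Real.exp (R + -(2 * Real.pi * (-n) * δ)) := by
          have : (0 : ℝ) ≤ -n := by linarith
          have : 0 ≤ R := (abs_nonneg _).trans hR
          gcongr
      _ = _ := by rw [Real.exp_add]; ring_nf

/-- On `D := {(w,z) : w/2 + πiτn ∉ πiℤ for all n ∈ ℤ, −Im τ < Im z < 0}`
the symmetric partial sums `S_M(w,z) := (1/2)·∑_{n=−M}^{M} e^{2πizn}·(1 + coth(w/2 + πiτn))`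
converge, as `M → ∞`, uniformly on every compact subset of `D` to the pointwise sum of the
(absolutely convergent) series. -/
theorem chi_series_uniform (τ : ℂ) (hτ : 0 < τ.im)
    (D : Set (ℂ × ℂ))
    (hD : D = {p : ℂ × ℂ |
      (∀ n m : ℤ, p.1 / 2 + (Real.pi : ℂ) * I * τ * (n : ℂ) ≠ (Real.pi : ℂ) * I * (m : ℂ)) ∧
      -τ.im < p.2.im ∧ p.2.im < 0})
    (K : Set (ℂ × ℂ)) (hK : IsCompact K) (hKD : K ⊆ D) :
    TendstoUniformlyOn
      (fun (M : ℕ) (p : ℂ × ℂ) => (1 / 2 : ℂ) * ∑ n ∈ Finset.Icc (-(M : ℤ)) (M : ℤ),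
        Complex.exp (2 * (Real.pi : ℂ) * I * p.2 * (n : ℂ)) *
          (1 + coth (p.1 / 2 + (Real.pi : ℂ) * I * τ * (n : ℂ))))
      (fun p : ℂ × ℂ => ∑' n : ℤ,
        (1 / 2 : ℂ) * Complex.exp (2 * (Real.pi : ℂ) * I * p.2 * (n : ℂ)) *
          (1 + coth (p.1 / 2 + (Real.pi : ℂ) * I * τ * (n : ℂ))))
      Filter.atTop K := by
  subst hD
  obtain ⟨δ, hδ, hδK⟩ : ∃ δ : ℝ, 0 < δ ∧ ∀ p ∈ K, δ ≤ min (-p.2.im) (p.2.im + τ.im) := by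
    refine hK.exists_forall_le' (by fun_prop) fun p hp => ?_
    obtain ⟨-, h1, h2⟩ := hKD hp
    exact lt_min (by linarith) (by linarith)
  obtain ⟨R, hR⟩ := hK.exists_bound_of_continuousOn (f := fun p : ℂ × ℂ => p.1.re) (by fun_prop)
  have hsum : Summable fun n : ℤ =>
      2 * Real.exp R * Real.exp (-(2 * Real.pi * δ) * |(n : ℝ)|) :=
    (summable_exp_neg_mul_abs_int (by positivity)).mul_left _
  have hlarge : ∀ᶠ n : ℤ in Filter.cofinite, R + 1 ≤ 2 * Real.pi * τ.im * |(n : ℝ)| := by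
    have habs : Filter.Tendsto (fun n : ℤ => |(n : ℝ)|) Filter.cofinite Filter.atTop := by
      simpa only [Function.comp_def, Real.norm_eq_abs] using
        (tendsto_norm_cocompact_atTop (E := ℝ)).comp Int.tendsto_coe_cofinite
    exact (habs.const_mul_atTop (by positivity)).eventually_ge_atTop _
  have hunif := tendstoUniformlyOn_tsum_of_cofinite_eventually (s := K)
    (f := fun (n : ℤ) (p : ℂ × ℂ) =>
      (1 / 2 : ℂ) * Complex.exp (2 * (Real.pi : ℂ) * I * p.2 * (n : ℂ)) *
        (1 + coth (p.1 / 2 + (Real.pi : ℂ) * I * τ * (n : ℂ)))) hsum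
    (hlarge.mono fun n hn p hp => norm_chi_series_term_le (hR p hp)
      ((hδK p hp).trans (min_le_left _ _)) ((hδK p hp).trans (min_le_right _ _)) hn)
  have hIcc : Filter.Tendsto (fun M : ℕ => Finset.Icc (-(M : ℤ)) (M : ℤ))
      Filter.atTop Filter.atTop :=
    Finset.tendsto_Icc_neg
  intro u hu
  filter_upwards [hIcc.eventually (hunif u hu)] with M hM p hp
  simpa only [Finset.mul_sum, mul_assoc] using hM p hp
end

section
/- Let Im τ > 0, let w ∈ ℂ satisfy w/2 + πiτn ∉ πiℤ for every n ∈ ℤ, and let z ∈ ℂ satisfy Im z ≥ 0 or Im z ≤ −Im τ. Then the family n ↦ e^{2πizn}·(1 + coth(w/2 + πiτn)), indexed by n ∈ ℤ, is NOT summable. (Hence the series representation of χ(w,z|τ) is valid only for z strictly inside the strip −Im τ < Im z < 0.) -/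
open Complex

open Filter Topology

theorem one_add_coth_mul_exp_sub_one {u : ℂ} (hu : exp (2 * u) ≠ 1) :
    (1 + coth u) * (exp (2 * u) - 1) = 2 * exp (2 * u) := by
  have hexp : exp (2 * u) = exp u * exp u := by rw [← Complex.exp_add, two_mul]
  have hinv : exp u * exp (-u) = 1 := by rw [← Complex.exp_add]; simp
  have hsinh : sinh u * exp u * 2 = exp (2 * u) - 1 := by
    rw [Complex.sinh, hexp]; linear_combination -hinv
  have hcosh : cosh u * exp u * 2 = exp (2 * u) + 1 := by
    rw [Complex.cosh, hexp]; linear_combination hinv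
  have hs : sinh u ≠ 0 := by
    intro h
    rw [h] at hsinh
    exact hu (by linear_combination -hsinh)
  have hc : coth u * sinh u = cosh u := div_mul_cancel₀ _ hs
  linear_combination -coth u * hsinh + hcosh + 2 * exp u * hc

theorem one_add_coth_mul_one_sub_exp_neg {u : ℂ} (hu : exp (2 * u) ≠ 1) :
    (1 + coth u) * (1 - exp (-(2 * u))) = 2 := by
  have hinv : exp (2 * u) * exp (-(2 * u)) = 1 := by rw [← Complex.exp_add]; simp
  linear_combination exp (-(2 * u)) * one_add_coth_mul_exp_sub_one hu +
    (2 - (1 + coth u)) * hinv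

theorem tendsto_exp_add_mul_natCast_zero (a : ℂ) {b : ℂ} (hb : b.re < 0) :
    Tendsto (fun k : ℕ => exp (a + b * k)) atTop (𝓝 0) := by
  have hq : ‖exp b‖ < 1 := by
    rw [Complex.norm_exp]; exact Real.exp_zero ▸ Real.exp_lt_exp.mpr hb
  simpa [Complex.exp_add, mul_comm b, Complex.exp_nat_mul] using
    (tendsto_pow_atTop_nhds_zero_of_norm_lt_one hq).const_mul (exp a)

theorem not_tendsto_exp_add_mul_natCast_zero (a : ℂ) {b : ℂ} (hb : 0 ≤ b.re) :
    ¬ Tendsto (fun k : ℕ => exp (a + b * k)) atTop (𝓝 0) := by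
  intro h
  have hle : ∀ k : ℕ, Real.exp a.re ≤ ‖exp (a + b * k)‖ := by
    intro k
    rw [Complex.norm_exp]
    apply Real.exp_le_exp.mpr
    have : 0 ≤ b.re * k := by positivity
    simpa using this
  have h0 := ge_of_tendsto' h.norm hle
  rw [norm_zero] at h0
  exact absurd h0 (not_le.mpr (Real.exp_pos _))

/-- For `Im τ > 0`, `w/2 + πiτn ∉ πiℤ` for all `n ∈ ℤ`, and `z` with
`Im z ≥ 0` or `Im z ≤ −Im τ`, the family `n ↦ e^{2πizn}·(1 + coth(w/2 + πiτn))`, `n ∈ ℤ`,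
is not summable.  (Hence the series representation of `χ(w,z|τ)` is valid only for `z`
strictly inside the strip `−Im τ < Im z < 0`.) -/
theorem chi_series_not_summable (τ w z : ℂ) (hτ : 0 < τ.im)
    (hw : ∀ n m : ℤ, w / 2 + (Real.pi : ℂ) * I * τ * (n : ℂ) ≠ (Real.pi : ℂ) * I * (m : ℂ))
    (hz : 0 ≤ z.im ∨ z.im ≤ -τ.im) :
    ¬ Summable (fun n : ℤ => Complex.exp (2 * (Real.pi : ℂ) * I * z * (n : ℂ)) *
        (1 + coth (w / 2 + (Real.pi : ℂ) * I * τ * (n : ℂ)))) := by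
  intro hs
  have hlim := hs.tendsto_cofinite_zero
  have hexp : ∀ n : ℤ, exp (2 * (w / 2 + (Real.pi : ℂ) * I * τ * (n : ℂ))) ≠ 1 := by
    intro n h
    obtain ⟨m, hm⟩ := Complex.exp_eq_one_iff.mp h
    exact hw n m (by linear_combination hm / 2)
  have hτ' : (2 * (Real.pi : ℂ) * I * τ).re < 0 := by
    simpa using mul_pos Real.two_pi_pos hτ
  rcases hz with hz | hz
  · have hinj : Function.Injective (fun k : ℕ => -(k : ℤ)) :=
      neg_injective.comp Nat.cast_injective
    have hf := hlim.comp (Nat.cofinite_eq_atTop ▸ hinj.tendsto_cofinite)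
    have hg := hf.mul ((tendsto_exp_add_mul_natCast_zero (-w) hτ').const_sub 1)
    rw [zero_mul] at hg
    refine not_tendsto_exp_add_mul_natCast_zero 0
      (b := -(2 * (Real.pi : ℂ) * I * z)) ?_ ?_
    · simpa using mul_nonneg Real.two_pi_pos.le hz
    · have hg' := hg.const_mul (1 / 2)
      rw [mul_zero] at hg'
      refine hg'.congr fun k => ?_
      have hk := one_add_coth_mul_one_sub_exp_neg (hexp (-(k : ℤ)))
      have hu : -(2 * (w / 2 + (Real.pi : ℂ) * I * τ * ((-(k : ℤ) : ℤ) : ℂ))) =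
          -w + 2 * (Real.pi : ℂ) * I * τ * k := by push_cast; ring
      have hE : 0 + -(2 * (Real.pi : ℂ) * I * z) * k =
          2 * (Real.pi : ℂ) * I * z * ((-(k : ℤ) : ℤ) : ℂ) := by push_cast; ring
      rw [hu] at hk
      rw [hE, Function.comp_apply]
      linear_combination
        exp (2 * (Real.pi : ℂ) * I * z * ((-(k : ℤ) : ℤ) : ℂ)) / 2 * hk
  · have hinj : Function.Injective (fun k : ℕ => (k : ℤ)) := Nat.cast_injective
    have hf := hlim.comp (Nat.cofinite_eq_atTop ▸ hinj.tendsto_cofinite)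
    have hg := hf.mul ((tendsto_exp_add_mul_natCast_zero w hτ').sub_const 1)
    rw [zero_mul] at hg
    refine not_tendsto_exp_add_mul_natCast_zero w
      (b := 2 * (Real.pi : ℂ) * I * (z + τ)) ?_ ?_
    · have : 2 * Real.pi * (z.im + τ.im) ≤ 0 :=
        mul_nonpos_of_nonneg_of_nonpos Real.two_pi_pos.le (by linarith)
      simpa using this
    · have hg' := hg.const_mul (1 / 2)
      rw [mul_zero] at hg'
      refine hg'.congr fun k => ?_
      have hk := one_add_coth_mul_exp_sub_one (hexp (k : ℤ))
      have hu : 2 * (w / 2 + (Real.pi : ℂ) * I * τ * ((k : ℤ) : ℂ)) =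
          w + 2 * (Real.pi : ℂ) * I * τ * k := by push_cast; ring
      have hE : exp (w + 2 * (Real.pi : ℂ) * I * (z + τ) * k) =
          exp (2 * (Real.pi : ℂ) * I * z * ((k : ℤ) : ℂ)) *
            exp (w + 2 * (Real.pi : ℂ) * I * τ * k) := by
        rw [← Complex.exp_add]; push_cast; ring_nf
      rw [hu] at hk
      rw [hE, Function.comp_apply]
      linear_combination
        exp (2 * (Real.pi : ℂ) * I * z * ((k : ℤ) : ℂ)) / 2 * hk
end

section
/- Fix k ∈ ℂ with Re k ≠ 0 and define 𝔅_k := {ω ∈ 𝔊₀ : for every a ∈ {1,…,N−1}, every eigenvalue λ of (ad ω)_a and every m ∈ ℤ one has λ + k(a + mN) ∉ 2πiℤ; and every eigenvalue λ of (ad ω)_0 satisfies λ ∉ 2πi(ℤ∖{0}) and λ + kmN ∉ 2πiℤ for all m ∈ ℤ∖{0}}. Then 𝔅_k is an open subset of 𝔊₀ and contains 0; in particular 𝔅_k is nonempty. (This is the content of Appendix A: the maximal domain of definition of the dynamical r-matrix on the twisted loop algebra is open and nonempty.) -/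
open Complex

/-- For a bilinear map on a finite-dimensional space, the set of `ω` for which `B ω` has an
eigenvector in a given subspace with eigenvalue in a given closed set is closed. -/
lemma isClosed_setOf_eigenvalue_mem {G : Type*} [NormedAddCommGroup G] [NormedSpace ℂ G]
    [FiniteDimensional ℂ G] (B : G →ₗ[ℂ] G →ₗ[ℂ] G) (V : Submodule ℂ G) {S : Set ℂ}
    (hS : IsClosed S) :
    IsClosed {ω : G | ∃ ev ∈ S, ∃ ξ ∈ V, ξ ≠ 0 ∧ B ω ξ = ev • ξ} := by
  have : ProperSpace G := FiniteDimensional.proper ℂ G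
  have hB : Continuous fun p : G × G => B p.1 p.2 :=
    (LinearMap.toContinuousBilinearMap B).continuous₂
  refine IsSeqClosed.isClosed fun u ω hu hω => ?_
  have hunit : ∀ n, ∃ ev ∈ S, ∃ ξ ∈ V, ‖ξ‖ = 1 ∧ B (u n) ξ = ev • ξ := by
    intro n
    obtain ⟨ev, hev, ξ, hξV, hξ, h⟩ := hu n
    refine ⟨ev, hev, ((‖ξ‖⁻¹ : ℝ) : ℂ) • ξ, V.smul_mem _ hξV, ?_, ?_⟩
    · rw [norm_smul, Complex.norm_real, norm_inv, norm_norm, inv_mul_cancel₀ (norm_ne_zero_iff.2 hξ)]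
    · rw [map_smul, h, smul_comm]
  choose ev hev ξ hξV hξ h using hunit
  obtain ⟨R, hR⟩ : ∃ R, ∀ n, ‖ev n‖ ≤ R := by
    obtain ⟨C, hC⟩ := ((hω.isCompact_insert_range.prod
      (isCompact_sphere (0 : G) 1)).image hB).isBounded.exists_norm_le
    refine ⟨C, fun n => ?_⟩
    have h1 := hC (B (u n) (ξ n)) ⟨(u n, ξ n), ⟨Or.inr ⟨n, rfl⟩, by simp [hξ n]⟩, rfl⟩
    rwa [h n, norm_smul, hξ n, mul_one] at h1
  obtain ⟨⟨e, x⟩, hex, φ, hφ, hlim⟩ :=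
    ((isCompact_closedBall (0 : ℂ) R).prod (isCompact_sphere (0 : G) 1)).tendsto_subseq
      (x := fun n => (ev n, ξ n)) fun n => ⟨by simpa using hR n, by simp [hξ n]⟩
  have he : Filter.Tendsto (fun n => ev (φ n)) Filter.atTop (nhds e) :=
    (continuous_fst.tendsto _).comp hlim
  have hx : Filter.Tendsto (fun n => ξ (φ n)) Filter.atTop (nhds x) :=
    (continuous_snd.tendsto _).comp hlim
  have hx1 : ‖x‖ = 1 := by simpa using hex.2
  refine ⟨e, hS.mem_of_tendsto he (.of_forall fun n => hev _), x,
    V.closed_of_finiteDimensional.mem_of_tendsto hx (.of_forall fun n => hξV _),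
    norm_ne_zero_iff.1 (by simp [hx1]), ?_⟩
  refine tendsto_nhds_unique (f := fun n => B (u (φ n)) (ξ (φ n)))
    ((hB.tendsto (ω, x)).comp ((hω.comp hφ.tendsto_atTop).prodMk_nhds hx)) ?_
  simp only [h]
  exact he.smul hx

/-- Any subset of a translate of the lattice spanned by `2πi` and a number with nonzero real part
is closed in `ℂ`. -/
lemma isClosed_image_lattice {d : ℂ} (hd : d.re ≠ 0) (c : ℂ) (T : Set (ℤ × ℤ)) :
    IsClosed ((fun p : ℤ × ℤ => 2 * (Real.pi : ℂ) * I * (p.2 : ℂ) - (c + d * (p.1 : ℂ))) '' T) := by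
  have hone : ∀ {a b : ℤ}, a ≠ b → (1 : ℝ) ≤ |(a : ℝ) - b| := fun {a b} hab => by
    exact_mod_cast Int.one_le_abs (sub_ne_zero.2 hab)
  refine (Metric.isClosedEmbedding_of_pairwise_le_dist
    (ε := min (2 * Real.pi) |d.re|) (by positivity) ?_).isClosedMap _ (isClosed_discrete T)
  rintro ⟨m, j⟩ ⟨m', j'⟩ hne
  rw [dist_eq_norm]
  by_cases hm : m = m'
  · subst hm
    have hj : j ≠ j' := fun h => hne (by rw [h])
    refine (min_le_left _ _).trans (le_trans ?_ (Complex.abs_im_le_norm _))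
    simp only [sub_im, add_im, mul_im, mul_re, I_re, I_im, ofReal_re, ofReal_im, intCast_re,
      intCast_im, re_ofNat, im_ofNat]
    ring_nf
    rw [show Real.pi * j * 2 - Real.pi * j' * 2 = Real.pi * 2 * (j - j') by ring, abs_mul,
      abs_of_pos (by positivity)]
    exact le_mul_of_one_le_right (by positivity) (hone hj)
  · refine (min_le_right _ _).trans (le_trans ?_ (Complex.abs_re_le_norm _))
    simp only [sub_re, add_re, mul_im, mul_re, I_re, I_im, ofReal_re, ofReal_im, intCast_re,
      intCast_im, re_ofNat, im_ofNat]
    ring_nf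
    rw [show -(d.re * m) + d.re * m' = d.re * (m' - m) by ring, abs_mul]
    exact le_mul_of_one_le_right (by positivity) (hone (Ne.symm hm))

/-- Let `𝔊` be a finite-dimensional complex Lie algebra (here a
finite-dimensional normed `ℂ`-space with a bilinear bracket satisfying the Lie algebra
axioms), `μ` a Lie algebra automorphism with `μ^N = id`, `N ≥ 1`, `ζ := exp(2πi/N)`,
`𝔊_a := ker(μ − ζ^a·id)` and `𝔊₀` the fixed-point subalgebra.  Fix `k ∈ ℂ` with
`Re k ≠ 0` and let `𝔅_k` be the set of `ω ∈ 𝔊₀` such that for every `a ∈ {1,…,N−1}`,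
every eigenvalue `λ` of `(ad ω)|_{𝔊_a}` and every `m ∈ ℤ` one has
`λ + k(a + mN) ∉ 2πiℤ`, and every eigenvalue `λ` of `(ad ω)|_{𝔊₀}` satisfies
`λ ∉ 2πi(ℤ∖{0})` and `λ + kmN ∉ 2πiℤ` for all `m ∈ ℤ∖{0}`.  Then `𝔅_k` is an open
subset of `𝔊₀` containing `0`; in particular it is nonempty. -/
theorem Bk_open_nonempty {G : Type*} [NormedAddCommGroup G] [NormedSpace ℂ G]
    [FiniteDimensional ℂ G]
    (bracket : G →ₗ[ℂ] G →ₗ[ℂ] G)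
    (halt : ∀ x : G, bracket x x = 0)
    (hleib : ∀ x y z : G,
      bracket x (bracket y z) = bracket (bracket x y) z + bracket y (bracket x z))
    (N : ℕ) (hN : 1 ≤ N)
    (μ : G ≃ₗ[ℂ] G) (hμN : ∀ x, (⇑μ)^[N] x = x)
    (hμbr : ∀ x y, μ (bracket x y) = bracket (μ x) (μ y))
    (ζ : ℂ) (hζ : ζ = Complex.exp (2 * (Real.pi : ℂ) * I / (N : ℂ)))
    (k : ℂ) (hk : k.re ≠ 0)
    (Bk : Set {x : G // μ x = x})
    (hBk : Bk = {ω : {x : G // μ x = x} |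
      (∀ a : ℕ, 1 ≤ a → a < N → ∀ ev : ℂ,
        (∃ ξ : G, ξ ≠ 0 ∧ μ ξ = ζ ^ a • ξ ∧ bracket (ω : G) ξ = ev • ξ) →
        ∀ m j : ℤ, ev + k * ((a : ℂ) + (m : ℂ) * (N : ℂ)) ≠
          2 * (Real.pi : ℂ) * I * (j : ℂ)) ∧
      (∀ ev : ℂ, (∃ ξ : G, ξ ≠ 0 ∧ μ ξ = ξ ∧ bracket (ω : G) ξ = ev • ξ) →
        (∀ j : ℤ, j ≠ 0 → ev ≠ 2 * (Real.pi : ℂ) * I * (j : ℂ)) ∧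
        (∀ m : ℤ, m ≠ 0 → ∀ j : ℤ, ev + k * (m : ℂ) * (N : ℂ) ≠
          2 * (Real.pi : ℂ) * I * (j : ℂ)))}) :
    IsOpen Bk ∧ (⟨0, map_zero μ⟩ : {x : G // μ x = x}) ∈ Bk := by
  have hN0 : (N : ℝ) ≠ 0 := by exact_mod_cast (by lia : N ≠ 0)
  have hd : (k * (N : ℂ)).re ≠ 0 := by simpa using ⟨hk, by lia⟩
  subst hBk
  refine ⟨?_, ?_, ?_⟩
  · rw [Set.ofPred_and]
    refine IsOpen.inter ?_ ?_
    · have hfin : {a : ℕ | 1 ≤ a ∧ a < N}.Finite :=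
        (Set.finite_lt_nat N).subset fun a ha => ha.2
      have hopen := hfin.isOpen_biInter fun a _ =>
        ((isClosed_setOf_eigenvalue_mem bracket
          (Module.End.eigenspace (μ : G →ₗ[ℂ] G) (ζ ^ a))
          (isClosed_image_lattice hd (k * a) Set.univ)).preimage
          (continuous_subtype_val (p := fun x : G => μ x = x))).isOpen_compl
      convert hopen using 1
      ext ω
      simp only [Set.mem_ofPred_eq, Set.mem_iInter, Set.mem_compl_iff, Set.mem_preimage,
        Module.End.mem_eigenspace_iff]
      constructor
      · rintro h a ⟨ha1, ha2⟩ ⟨ev, ⟨⟨m, j⟩, -, hev⟩, ξ, hξμ, hξ, hb⟩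
        refine h a ha1 ha2 ev ⟨ξ, hξ, hξμ, hb⟩ m j ?_
        rw [← hev]; ring
      · rintro h a ha1 ha2 ev ⟨ξ, hξ, hξμ, hb⟩ m j hev
        refine h a ⟨ha1, ha2⟩ ⟨ev, ⟨(m, j), trivial, ?_⟩, ξ, hξμ, hξ, hb⟩
        simp only
        rw [← hev]; ring
    · have hopen := ((isClosed_setOf_eigenvalue_mem bracket
        (Module.End.eigenspace (μ : G →ₗ[ℂ] G) 1)
        (isClosed_image_lattice hd 0 {0}ᶜ)).preimage
        (continuous_subtype_val (p := fun x : G => μ x = x))).isOpen_compl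
      convert hopen using 1
      ext ω
      simp only [Set.mem_ofPred_eq, Set.mem_compl_iff, Set.mem_preimage,
        Module.End.mem_eigenspace_iff, one_smul]
      constructor
      · rintro h ⟨ev, ⟨⟨m, j⟩, hmj, hev⟩, ξ, hξμ, hξ, hb⟩
        obtain ⟨h1, h2⟩ := h ev ⟨ξ, hξ, hξμ, hb⟩
        by_cases hm : m = 0
        · subst hm
          exact h1 j (fun hj => hmj (by simp [hj])) (by rw [← hev]; simp)
        · exact h2 m hm j (by rw [← hev]; ring)
      · rintro h ev ⟨ξ, hξ, hξμ, hb⟩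
        refine ⟨fun j hj hev => ?_, fun m hm j hev => ?_⟩
        · exact h ⟨ev, ⟨(0, j), by simp [hj], by simp [hev]⟩, ξ, hξμ, hξ, hb⟩
        · refine h ⟨ev, ⟨(m, j), by simp [hm], ?_⟩, ξ, hξμ, hξ, hb⟩
          simp only
          rw [← hev]; ring
  · rintro a ha1 ha2 ev ⟨ξ, hξ, -, hb⟩ m j h
    obtain rfl : ev = 0 := by simpa [hξ, eq_comm] using hb
    have h1 := congrArg Complex.re h
    simp [hk] at h1
    have h2 : (a : ℤ) + m * N = 0 := by exact_mod_cast h1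
    have h3 : (N : ℤ) ∣ a := ⟨-m, by linarith⟩
    exact absurd (Nat.le_of_dvd ha1 (Int.natCast_dvd_natCast.1 h3)) (by lia)
  · rintro ev ⟨ξ, hξ, -, hb⟩
    obtain rfl : ev = 0 := by simpa [hξ, eq_comm] using hb
    refine ⟨fun j hj h => ?_, fun m hm j h => ?_⟩
    · simp [hj, Real.pi_ne_zero] at h
    · have h1 := congrArg Complex.re h
      simp [hk, hm, hN0] at h1
end

section
/- For every ω ∈ U and all X, Y ∈ 𝔊 the modified classical dynamical Yang–Baxter equation holds: [ρ(ω)X, ρ(ω)Y] − ρ(ω)([X, ρ(ω)Y] + [ρ(ω)X, Y]) + ∑_i K^i · B(X, (∇_{K_i}ρ)(ω)Y) + (∇_{Y₀}ρ)(ω)X − (∇_{X₀}ρ)(ω)Y = −(1/4)·[X, Y]. (This is the claim of Appendix B that the dynamical r-matrix ρ_q associated with the finite order automorphism μ and the integer q satisfies the CDYBE, formulated on the neighbourhood U of 0 where ρ_q is given by its convergent power series.) -/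
open Complex

open Finset MvPolynomial in
/-- Cauchy product of two absolutely convergent series along a continuous bilinear map. -/
theorem hasSum_bilin_antidiagonal {E F H : Type*} [NormedAddCommGroup E] [NormedSpace ℂ E]
    [NormedAddCommGroup F] [NormedSpace ℂ F] [NormedAddCommGroup H] [NormedSpace ℂ H]
    [CompleteSpace H] (β : E →L[ℂ] F →L[ℂ] H) {u : ℕ → E} {v : ℕ → F} {U : E} {V : F}
    (hu : HasSum u U) (hv : HasSum v V)
    (hu' : Summable fun n => ‖u n‖) (hv' : Summable fun n => ‖v n‖) :
    HasSum (fun d => ∑ p ∈ antidiagonal d, β (u p.1) (v p.2)) (β U V) := by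
  have hs : Summable fun p : ℕ × ℕ => β (u p.1) (v p.2) := by
    refine Summable.of_norm_bounded
      (g := fun p : ℕ × ℕ => ‖β‖ * (‖u p.1‖ * ‖v p.2‖)) ?_ ?_
    · exact (hu'.mul_of_nonneg hv' (fun _ => norm_nonneg _) (fun _ => norm_nonneg _)).mul_left _
    · intro p
      rw [← mul_assoc]
      exact β.le_opNorm₂ _ _
  have h1 : HasSum (fun n => β (u n) V) (∑' p : ℕ × ℕ, β (u p.1) (v p.2)) :=
    hs.hasSum.prod_fiberwise fun n => (β (u n)).hasSum hv
  have h2 : HasSum (fun n => β (u n) V) (β U V) := (β.flip V).hasSum hu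
  have h3 : HasSum (fun p : ℕ × ℕ => β (u p.1) (v p.2)) (β U V) := h1.unique h2 ▸ hs.hasSum
  refine ((HasAntidiagonal.sigmaAntidiagonalEquivProd (A := ℕ)).hasSum_iff.mpr h3).sigma
    fun d => ?_
  rw [← Finset.sum_coe_sort]
  exact hasSum_fintype _

/-- A power series vanishing on a punctured neighbourhood of `0` has zero coefficients. -/
theorem coeff_eq_zero_of_hasSum_zero {p : ℕ → ℂ} {ε : ℝ} (hε : 0 < ε)
    (h : ∀ t : ℂ, t ≠ 0 → ‖t‖ < ε → HasSum (fun n => t ^ n * p n) 0) (n : ℕ) : p n = 0 := by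
  let f : ℂ → ℂ := fun t => if t = 0 then p 0 else 0
  let P := FormalMultilinearSeries.ofScalars ℂ p
  have hP : HasFPowerSeriesAt f P 0 := by
    rw [hasFPowerSeriesAt_iff]
    filter_upwards [Metric.ball_mem_nhds (0 : ℂ) hε] with t ht
    simp only [P, FormalMultilinearSeries.coeff_ofScalars, zero_add, f, smul_eq_mul]
    split_ifs with h0
    · subst h0
      convert! hasSum_single (f := fun n => (0 : ℂ) ^ n * p n) 0 ?_ using 1
      · simp
      · intro n hn
        simp [hn]
    · exact h t h0 (by simpa using ht)
  have hp0 : p 0 = 0 := by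
    have h1 : Filter.Tendsto f (nhdsWithin 0 {0}ᶜ) (nhds (f 0)) :=
      hP.continuousAt.tendsto.mono_left nhdsWithin_le_nhds
    have h2 : Filter.Tendsto f (nhdsWithin 0 {0}ᶜ) (nhds 0) := by
      refine tendsto_const_nhds.congr' ?_
      filter_upwards [self_mem_nhdsWithin] with t ht
      simp only [f]
      rw [if_neg (by simpa using ht)]
    simpa [f] using tendsto_nhds_unique h1 h2
  have hf : f = 0 := by
    funext t
    simp [f, hp0]
  have := (hf ▸ hP).eq_zero
  rw [← FormalMultilinearSeries.coeff_ofScalars (𝕜 := ℂ) (p := p) (n := n)]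
  change P.coeff n = 0
  rw [this]
  rfl

section PolynomialCalculus

open Finset MvPolynomial

variable {E F H : Type*} [NormedAddCommGroup E] [NormedSpace ℂ E]
  [NormedAddCommGroup F] [NormedSpace ℂ F] [NormedAddCommGroup H] [NormedSpace ℂ H]

/-- The linear map sending the monomial `x^i y^j` to `β (L₁^i X) (L₂^j Y)`. -/
noncomputable def bilinEval (β : E →L[ℂ] F →L[ℂ] H) (L₁ : E →L[ℂ] E) (L₂ : F →L[ℂ] F)
    (X : E) (Y : F) : MvPolynomial (Fin 2) ℂ →ₗ[ℂ] H :=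
  (basisMonomials (Fin 2) ℂ).constr ℂ fun s => β ((L₁ ^ s 0) X) ((L₂ ^ s 1) Y)

variable (β : E →L[ℂ] F →L[ℂ] H) {L₁ : E →L[ℂ] E} {L₂ : F →L[ℂ] F} {L₃ : H →L[ℂ] H}

theorem bilinEval_monomial (X : E) (Y : F) (s : Fin 2 →₀ ℕ) (a : ℂ) :
    bilinEval β L₁ L₂ X Y (monomial s a) = a • β ((L₁ ^ s 0) X) ((L₂ ^ s 1) Y) := by
  have : monomial s a = a • basisMonomials (Fin 2) ℂ s := by simp [smul_monomial]
  rw [this, map_smul, bilinEval, Module.Basis.constr_basis]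

theorem bilinEval_X_zero_mul (X : E) (Y : F) (p : MvPolynomial (Fin 2) ℂ) :
    bilinEval β L₁ L₂ X Y (MvPolynomial.X 0 * p) = bilinEval β L₁ L₂ (L₁ X) Y p := by
  induction p using MvPolynomial.induction_on' with
  | monomial s a =>
    rw [mul_comm, MvPolynomial.X, monomial_mul, bilinEval_monomial, bilinEval_monomial]
    simp [pow_succ]
  | add p q hp hq => rw [mul_add, map_add, map_add, hp, hq]

theorem bilinEval_X_one_mul (X : E) (Y : F) (p : MvPolynomial (Fin 2) ℂ) :
    bilinEval β L₁ L₂ X Y (MvPolynomial.X 1 * p) = bilinEval β L₁ L₂ X (L₂ Y) p := by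
  induction p using MvPolynomial.induction_on' with
  | monomial s a =>
    rw [mul_comm, MvPolynomial.X, monomial_mul, bilinEval_monomial, bilinEval_monomial]
    simp [pow_succ]
  | add p q hp hq => rw [mul_add, map_add, map_add, hp, hq]

theorem bilinEval_one (X : E) (Y : F) : bilinEval β L₁ L₂ X Y 1 = β X Y := by
  rw [← C_1, C_apply, bilinEval_monomial]
  simp

theorem bilinEval_X_pow_mul_X_pow (X : E) (Y : F) (i j : ℕ) :
    bilinEval β L₁ L₂ X Y (MvPolynomial.X 0 ^ i * MvPolynomial.X 1 ^ j) =
      β ((L₁ ^ i) X) ((L₂ ^ j) Y) := by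
  rw [X_pow_eq_monomial, X_pow_eq_monomial, monomial_mul, bilinEval_monomial]
  simp

theorem bilinEval_X_zero_add_X_one_mul
    (hL : ∀ u v, L₃ (β u v) = β (L₁ u) v + β u (L₂ v)) (X : E) (Y : F)
    (p : MvPolynomial (Fin 2) ℂ) :
    bilinEval β L₁ L₂ X Y ((MvPolynomial.X 0 + MvPolynomial.X 1) * p) =
      L₃ (bilinEval β L₁ L₂ X Y p) := by
  rw [add_mul, map_add, bilinEval_X_zero_mul, bilinEval_X_one_mul]
  induction p using MvPolynomial.induction_on' with
  | monomial s a =>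
    simp only [bilinEval_monomial, map_smul, hL, smul_add]
    simp only [← mul_apply_eq_comp, ← pow_succ, ← pow_succ']
  | add p q hp hq => simp only [map_add, ← hp, ← hq]; abel

theorem bilinEval_X_zero_add_X_one_pow_mul
    (hL : ∀ u v, L₃ (β u v) = β (L₁ u) v + β u (L₂ v)) (X : E) (Y : F) (n : ℕ)
    (p : MvPolynomial (Fin 2) ℂ) :
    bilinEval β L₁ L₂ X Y ((MvPolynomial.X 0 + MvPolynomial.X 1) ^ n * p) =
      (L₃ ^ n) (bilinEval β L₁ L₂ X Y p) := by
  induction n with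
  | zero => simp
  | succ n ih =>
    rw [pow_succ', mul_assoc, bilinEval_X_zero_add_X_one_mul β hL, ih, pow_succ']
    rfl

/-- The degree `d` part of `u(α) v(γ)` for formal power series `u = ∑ uₙ xⁿ`, `v = ∑ vₙ xⁿ`. -/
noncomputable def mulPart (α γ : MvPolynomial (Fin 2) ℂ) (u v : ℕ → ℂ) (d : ℕ) :
    MvPolynomial (Fin 2) ℂ :=
  ∑ p ∈ antidiagonal d, (u p.1 * v p.2) • (α ^ p.1 * γ ^ p.2)

/-- The degree `d` part of the divided difference `(u(α) - u(γ)) / (α - γ)`. -/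
noncomputable def diffPart (α γ : MvPolynomial (Fin 2) ℂ) (u : ℕ → ℂ) (d : ℕ) :
    MvPolynomial (Fin 2) ℂ :=
  u (d + 1) • ∑ p ∈ antidiagonal d, α ^ p.1 * γ ^ p.2

theorem bilinEval_mulPart (X : E) (Y : F) (u v : ℕ → ℂ) (d : ℕ) :
    bilinEval β L₁ L₂ X Y (mulPart (MvPolynomial.X 0) (MvPolynomial.X 1) u v d) =
      ∑ p ∈ antidiagonal d, β (u p.1 • (L₁ ^ p.1) X) (v p.2 • (L₂ ^ p.2) Y) := by
  simp only [mulPart, map_sum, map_smul, bilinEval_X_pow_mul_X_pow,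
    smul_apply, smul_smul]
  exact Finset.sum_congr rfl fun _ _ => by rw [mul_comm]

theorem bilinEval_mulPart_right
    (hL : ∀ u v, L₃ (β u v) = β (L₁ u) v + β u (L₂ v))
    (X : E) (Y : F) (u v : ℕ → ℂ) (d : ℕ) :
    bilinEval β L₁ L₂ X Y
        (mulPart (MvPolynomial.X 0 + MvPolynomial.X 1) (MvPolynomial.X 1) u v d) =
      ∑ p ∈ antidiagonal d, (u p.1 • L₃ ^ p.1) (β X (v p.2 • (L₂ ^ p.2) Y)) := by
  simp only [mulPart, map_sum, map_smul, bilinEval_X_zero_add_X_one_pow_mul β hL,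
    smul_apply, smul_smul]
  refine Finset.sum_congr rfl fun p _ => ?_
  have := bilinEval_X_pow_mul_X_pow (L₁ := L₁) (L₂ := L₂) β X Y 0 p.2
  rw [pow_zero, one_mul] at this
  rw [this, pow_zero, mul_comm]
  rfl

theorem bilinEval_mulPart_left
    (hL : ∀ u v, L₃ (β u v) = β (L₁ u) v + β u (L₂ v))
    (X : E) (Y : F) (u v : ℕ → ℂ) (d : ℕ) :
    bilinEval β L₁ L₂ X Y
        (mulPart (MvPolynomial.X 0 + MvPolynomial.X 1) (MvPolynomial.X 0) u v d) =
      ∑ p ∈ antidiagonal d, (u p.1 • L₃ ^ p.1) (β (v p.2 • (L₁ ^ p.2) X) Y) := by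
  simp only [mulPart, map_sum, map_smul, bilinEval_X_zero_add_X_one_pow_mul β hL,
    smul_apply, smul_smul]
  refine Finset.sum_congr rfl fun p _ => ?_
  have := bilinEval_X_pow_mul_X_pow (L₁ := L₁) (L₂ := L₂) β X Y p.2 0
  rw [pow_zero, mul_one] at this
  rw [this, pow_zero, mul_comm]
  rfl

theorem bilinEval_diffPart_right
    (hL : ∀ u v, L₃ (β u v) = β (L₁ u) v + β u (L₂ v))
    (X : E) (Y : F) (u : ℕ → ℂ) (d : ℕ) :
    bilinEval β L₁ L₂ X Y
        (diffPart (MvPolynomial.X 0 + MvPolynomial.X 1) (MvPolynomial.X 1) u d) =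
      u (d + 1) • ∑ p ∈ antidiagonal d, (L₃ ^ p.1) (β X ((L₂ ^ p.2) Y)) := by
  simp only [diffPart, map_sum, map_smul, bilinEval_X_zero_add_X_one_pow_mul β hL]
  congr 1
  refine Finset.sum_congr rfl fun p _ => ?_
  have := bilinEval_X_pow_mul_X_pow (L₁ := L₁) (L₂ := L₂) β X Y 0 p.2
  rw [pow_zero, one_mul] at this
  rw [this, pow_zero]
  rfl

theorem bilinEval_diffPart_left
    (hL : ∀ u v, L₃ (β u v) = β (L₁ u) v + β u (L₂ v))
    (X : E) (Y : F) (u : ℕ → ℂ) (d : ℕ) :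
    bilinEval β L₁ L₂ X Y
        (diffPart (MvPolynomial.X 0 + MvPolynomial.X 1) (MvPolynomial.X 0) u d) =
      u (d + 1) • ∑ p ∈ antidiagonal d, (L₃ ^ p.1) (β ((L₁ ^ p.2) X) Y) := by
  simp only [diffPart, map_sum, map_smul, bilinEval_X_zero_add_X_one_pow_mul β hL]
  congr 1
  refine Finset.sum_congr rfl fun p _ => ?_
  have := bilinEval_X_pow_mul_X_pow (L₁ := L₁) (L₂ := L₂) β X Y p.2 0
  rw [pow_zero, mul_one] at this
  rw [this, pow_zero]
  rfl

theorem bilinEval_diffPart_neg (X : E) (Y : F) (u : ℕ → ℂ) (d : ℕ) :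
    bilinEval β L₁ L₂ X Y (diffPart (-MvPolynomial.X 0) (MvPolynomial.X 1) u d) =
      u (d + 1) • ∑ p ∈ antidiagonal d,
        (-1 : ℂ) ^ p.1 • β ((L₁ ^ p.1) X) ((L₂ ^ p.2) Y) := by
  simp only [diffPart, map_sum, map_smul]
  congr 1
  refine Finset.sum_congr rfl fun p _ => ?_
  have : (-MvPolynomial.X 0 : MvPolynomial (Fin 2) ℂ) ^ p.1 * MvPolynomial.X 1 ^ p.2 =
      (-1 : ℂ) ^ p.1 • (MvPolynomial.X 0 ^ p.1 * MvPolynomial.X 1 ^ p.2) := by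
    rw [neg_pow, mul_assoc, smul_eq_C_mul]
    simp
  rw [this, map_smul, bilinEval_X_pow_mul_X_pow]

end PolynomialCalculus

section ScalarIdentity

open Finset MvPolynomial

theorem hasSum_eval_mulPart {u v : ℕ → ℂ} {α γ : MvPolynomial (Fin 2) ℂ} {e : Fin 2 → ℂ} {U V : ℂ}
    (hu : HasSum (fun n => u n * eval e α ^ n) U) (hv : HasSum (fun n => v n * eval e γ ^ n) V) :
    HasSum (fun d => eval e (mulPart α γ u v d)) (U * V) := by
  have := hasSum_bilin_antidiagonal (ContinuousLinearMap.mul ℂ ℂ) hu hv hu.summable.norm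
    hv.summable.norm
  refine this.congr_fun ?_
  intro d
  simp only [mulPart, map_sum, smul_eval, map_mul, map_pow, ContinuousLinearMap.mul_apply']
  exact Finset.sum_congr rfl fun _ _ => by ring

theorem hasSum_eval_diffPart {u : ℕ → ℂ} {α γ : MvPolynomial (Fin 2) ℂ} {e : Fin 2 → ℂ} {U V : ℂ}
    (hu : HasSum (fun n => u n * eval e α ^ n) U) (hv : HasSum (fun n => u n * eval e γ ^ n) V)
    (hne : eval e α - eval e γ ≠ 0) :
    HasSum (fun d => eval e (diffPart α γ u d)) ((U - V) / (eval e α - eval e γ)) := by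
  have h1 : HasSum (fun n => u n * eval e α ^ n - u n * eval e γ ^ n) (U - V) := hu.sub hv
  have h2 := (hasSum_nat_add_iff (f := fun n => u n * eval e α ^ n - u n * eval e γ ^ n)
    (g := U - V) 1).mpr (by simpa using h1)
  refine (h2.div_const (eval e α - eval e γ)).congr_fun ?_
  intro d
  simp only [diffPart, map_sum, smul_eval, map_mul, map_pow,
    Finset.Nat.sum_antidiagonal_eq_sum_range_succ_mk]
  rw [eq_div_iff hne, ← mul_sub, ← (Commute.all (eval e α) (eval e γ)).mul_geom_sum₂ (d + 1)]
  simp only [Nat.add_sub_cancel, Nat.succ_eq_add_one]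
  ring

theorem eval_smul_mulPart {u v : ℕ → ℂ} {α γ : MvPolynomial (Fin 2) ℂ} {e e' : Fin 2 → ℂ} {t : ℂ}
    (hα : eval e' α = t * eval e α) (hγ : eval e' γ = t * eval e γ) (d : ℕ) :
    eval e' (mulPart α γ u v d) = t ^ d * eval e (mulPart α γ u v d) := by
  simp only [mulPart, map_sum, smul_eval, map_mul, map_pow, hα, hγ, Finset.mul_sum]
  refine Finset.sum_congr rfl fun p hp => ?_
  rw [← mem_antidiagonal.mp hp]
  ring

theorem eval_smul_diffPart {u : ℕ → ℂ} {α γ : MvPolynomial (Fin 2) ℂ} {e e' : Fin 2 → ℂ} {t : ℂ}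
    (hα : eval e' α = t * eval e α) (hγ : eval e' γ = t * eval e γ) (d : ℕ) :
    eval e' (diffPart α γ u d) = t ^ d * eval e (diffPart α γ u d) := by
  simp only [diffPart, map_sum, smul_eval, map_mul, map_pow, hα, hγ, Finset.mul_sum]
  refine Finset.sum_congr rfl fun p hp => ?_
  rw [← mem_antidiagonal.mp hp]
  ring

/-- The degree `d` part of the two-variable power series expressing the defect of the modified
classical dynamical Yang–Baxter equation. -/
noncomputable def cdybePart (ca cb cs : ℕ → ℂ) (εa εb εs : ℂ) (d : ℕ) :
    MvPolynomial (Fin 2) ℂ :=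
  mulPart (X 0) (X 1) ca cb d - mulPart (X 0 + X 1) (X 1) cs cb d
    - mulPart (X 0 + X 1) (X 0) cs ca d - εs • diffPart (-X 0) (X 1) cb d
    - εb • diffPart (X 0 + X 1) (X 0) ca d - εa • diffPart (X 0 + X 1) (X 1) cb d
    + (if d = 0 then C (1 / 4) else 0)

theorem hasSum_eval_cdybePart {ca cb cs : ℕ → ℂ} {fa fb fs : ℂ → ℂ} {εa εb εs z w : ℂ}
    (hz : z ≠ 0) (hw : w ≠ 0) (hzw : z + w ≠ 0)
    (haz : HasSum (fun n => ca n * z ^ n) (fa z))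
    (hazw : HasSum (fun n => ca n * (z + w) ^ n) (fa (z + w)))
    (hbw : HasSum (fun n => cb n * w ^ n) (fb w))
    (hbz : HasSum (fun n => cb n * (-z) ^ n) (fb (-z)))
    (hbzw : HasSum (fun n => cb n * (z + w) ^ n) (fb (z + w)))
    (hszw : HasSum (fun n => cs n * (z + w) ^ n) (fs (z + w))) :
    HasSum (fun d => eval ![z, w] (cdybePart ca cb cs εa εb εs d))
      (fa z * fb w - fs (z + w) * fb w - fs (z + w) * fa z
        - εs * ((fb (-z) - fb w) / (-z - w))
        - εb * ((fa (z + w) - fa z) / w) - εa * ((fb (z + w) - fb w) / z) + 1 / 4) := by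
  have e0 : eval ![z, w] (X 0 : MvPolynomial (Fin 2) ℂ) = z := by simp
  have e1 : eval ![z, w] (X 1 : MvPolynomial (Fin 2) ℂ) = w := by simp
  have e2 : eval ![z, w] (X 0 + X 1 : MvPolynomial (Fin 2) ℂ) = z + w := by simp
  have e3 : eval ![z, w] (-X 0 : MvPolynomial (Fin 2) ℂ) = -z := by simp
  rw [← e0] at haz
  rw [← e1] at hbw
  rw [← e2] at hazw hbzw hszw
  rw [← e3] at hbz
  have d1 : eval ![z, w] (X 0 + X 1 : MvPolynomial (Fin 2) ℂ) - eval ![z, w] (X 0) = w := by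
    rw [e2, e0, add_sub_cancel_left]
  have d2 : eval ![z, w] (X 0 + X 1 : MvPolynomial (Fin 2) ℂ) - eval ![z, w] (X 1) = z := by
    rw [e2, e1, add_sub_cancel_right]
  have d3 : eval ![z, w] (-X 0 : MvPolynomial (Fin 2) ℂ) - eval ![z, w] (X 1) = -z - w := by
    rw [e3, e1]
  have hzw' : -z - w ≠ 0 := fun h0 => hzw (by linear_combination -h0)
  have h1 := hasSum_eval_mulPart haz hbw
  have h2 := hasSum_eval_mulPart hszw hbw
  have h3 := hasSum_eval_mulPart hszw haz
  have h4 := hasSum_eval_diffPart hbz hbw (by rwa [d3])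
  have h5 := hasSum_eval_diffPart hazw haz (by rwa [d1])
  have h6 := hasSum_eval_diffPart hbzw hbw (by rwa [d2])
  have h7 : HasSum (fun d : ℕ => if d = 0 then (1 / 4 : ℂ) else 0) (1 / 4) :=
    hasSum_ite_eq 0 _
  rw [d3, e3, e1] at h4
  rw [d1, e2, e0] at h5
  rw [d2, e2, e1] at h6
  rw [e0, e1] at h1
  rw [e2, e1] at h2
  rw [e2, e0] at h3
  refine ((((((h1.sub h2).sub h3).sub (h4.mul_left εs)).sub (h5.mul_left εb)).sub
    (h6.mul_left εa)).add h7).congr_fun fun d => ?_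
  simp only [cdybePart, map_add, map_sub, smul_eval]
  split_ifs <;> simp

theorem cdybePart_eq_zero {ca cb cs : ℕ → ℂ} {fa fb fs : ℂ → ℂ} {εa εb εs : ℂ} {δ : ℝ}
    (hδ : 0 < δ)
    (ha : ∀ z, z ≠ 0 → ‖z‖ < δ → HasSum (fun n => ca n * z ^ n) (fa z))
    (hb : ∀ z, z ≠ 0 → ‖z‖ < δ → HasSum (fun n => cb n * z ^ n) (fb z))
    (hs : ∀ z, z ≠ 0 → ‖z‖ < δ → HasSum (fun n => cs n * z ^ n) (fs z))
    (h : ∀ z w, z ≠ 0 → w ≠ 0 → z + w ≠ 0 → ‖z‖ < δ → ‖w‖ < δ → ‖z + w‖ < δ →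
      fa z * fb w - fs (z + w) * fb w - fs (z + w) * fa z
        - εs * ((fb (-z) - fb w) / (-z - w))
        - εb * ((fa (z + w) - fa z) / w) - εa * ((fb (z + w) - fb w) / z) + 1 / 4 = 0)
    (d : ℕ) : cdybePart ca cb cs εa εb εs d = 0 := by
  have key : ∀ x y : ℂ, x ≠ 0 → y ≠ 0 → x + y ≠ 0 →
      eval ![x, y] (cdybePart ca cb cs εa εb εs d) = 0 := by
    intro x y hx hy hxy
    have hC : 0 < ‖x‖ + ‖y‖ := by positivity
    refine coeff_eq_zero_of_hasSum_zero
      (p := fun d => eval ![x, y] (cdybePart ca cb cs εa εb εs d))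
      (div_pos hδ hC) (fun t ht htδ => ?_) d
    have hbd : ‖t‖ * (‖x‖ + ‖y‖) < δ := (lt_div_iff₀ hC).mp htδ
    have h1 : ‖t * x‖ < δ := by
      rw [norm_mul]
      nlinarith [norm_nonneg t, norm_nonneg x, norm_nonneg y]
    have h2 : ‖t * y‖ < δ := by
      rw [norm_mul]
      nlinarith [norm_nonneg t, norm_nonneg x, norm_nonneg y]
    have h3 : ‖t * x + t * y‖ < δ := by
      rw [← mul_add, norm_mul]
      nlinarith [norm_nonneg t, norm_add_le x y]
    have hx' := mul_ne_zero ht hx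
    have hy' := mul_ne_zero ht hy
    have hxy' : t * x + t * y ≠ 0 := by
      rw [← mul_add]
      exact mul_ne_zero ht hxy
    have := hasSum_eval_cdybePart (εa := εa) (εb := εb) (εs := εs) hx' hy' hxy'
      (ha _ hx' h1) (ha _ hxy' h3) (hb _ hy' h2)
      (hb _ (neg_ne_zero.mpr hx') (by rwa [norm_neg])) (hb _ hxy' h3) (hs _ hxy' h3)
    rw [h _ _ hx' hy' hxy' h1 h2 h3] at this
    refine this.congr_fun ?_
    intro n
    have e0 : eval ![t * x, t * y] (X 0 : MvPolynomial (Fin 2) ℂ) = t * eval ![x, y] (X 0) := by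
      simp
    have e1 : eval ![t * x, t * y] (X 1 : MvPolynomial (Fin 2) ℂ) = t * eval ![x, y] (X 1) := by
      simp
    have e2 : eval ![t * x, t * y] (X 0 + X 1 : MvPolynomial (Fin 2) ℂ) =
        t * eval ![x, y] (X 0 + X 1) := by
      simp [mul_add]
    have e3 : eval ![t * x, t * y] (-X 0 : MvPolynomial (Fin 2) ℂ) =
        t * eval ![x, y] (-X 0) := by
      simp
    simp only [cdybePart, map_add, map_sub, smul_eval, eval_smul_mulPart e0 e1,
      eval_smul_mulPart e2 e1, eval_smul_mulPart e2 e0, eval_smul_diffPart e3 e1,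
      eval_smul_diffPart e2 e0, eval_smul_diffPart e2 e1]
    split_ifs with hn
    · subst hn
      simp
    · simp
      ring
  have hmul : cdybePart ca cb cs εa εb εs d * (X 0 * X 1 * (X 0 + X 1)) = 0 := by
    refine MvPolynomial.funext fun e => ?_
    have he : e = ![e 0, e 1] := by
      ext i
      fin_cases i <;> rfl
    rw [he]
    by_cases hx : e 0 = 0
    · simp [hx]
    by_cases hy : e 1 = 0
    · simp [hy]
    by_cases hxy : e 0 + e 1 = 0
    · simp [hxy]
    · simp [key _ _ hx hy hxy]
  have hne : (X 0 * X 1 * (X 0 + X 1) : MvPolynomial (Fin 2) ℂ) ≠ 0 := by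
    intro h0
    have := congrArg (eval ![1, 1]) h0
    norm_num at this
  exact (mul_eq_zero.mp hmul).resolve_right hne

end ScalarIdentity

section Coth

open Complex

theorem coth_neg (u : ℂ) : coth (-u) = -coth u := by
  simp [coth, div_neg]

theorem coth_add {u v : ℂ} (hu : sinh u ≠ 0) (hv : sinh v ≠ 0) (huv : sinh (u + v) ≠ 0) :
    coth (u + v) * (coth u + coth v) = 1 + coth u * coth v := by
  unfold coth
  rw [sinh_add] at huv
  rw [sinh_add, cosh_add, div_mul_eq_mul_div, div_eq_iff huv]
  field_simp
  ring

theorem coth_add_nat_mul_pi_mul_I (u : ℂ) (n : ℕ) : coth (u + n * (Real.pi * I)) = coth u := by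
  induction n with
  | zero => simp
  | succ n ih =>
    rw [← ih, Nat.cast_succ, add_mul, one_mul, ← add_assoc]
    generalize u + n * (Real.pi * I) = v
    simp [coth, cosh_add, sinh_add, cosh_mul_I, sinh_mul_I]

theorem sinh_ne_zero_of_norm_lt {N q a : ℕ} (hN : N ≠ 0) {w : ℂ} (hw : w ≠ 0)
    (hwN : ‖w‖ < 2 * Real.pi / N) :
    sinh ((w + (2 * (Real.pi : ℂ) * I / (N : ℂ)) * q * a) / 2) ≠ 0 := by
  intro h
  have hN' : (N : ℂ) ≠ 0 := Nat.cast_ne_zero.mpr hN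
  have hNR : (0 : ℝ) < N := Nat.cast_pos.mpr (Nat.pos_of_ne_zero hN)
  set v := w + (2 * (Real.pi : ℂ) * I / (N : ℂ)) * q * a with hv
  have h1 : exp v = 1 := by
    have h2 : exp (v / 2) = exp (-(v / 2)) := by
      rw [sinh, div_eq_zero_iff] at h
      exact sub_eq_zero.mp (h.resolve_right two_ne_zero)
    calc exp v = exp (v / 2) * exp (v / 2) := by rw [← exp_add]; ring_nf
      _ = exp (v / 2) * exp (-(v / 2)) := by rw [← h2]
      _ = 1 := by rw [← exp_add]; simp
  obtain ⟨n, hn⟩ := exp_eq_one_iff.mp h1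
  have hwn : w = (((n * N - q * a : ℤ) : ℂ)) * (2 * Real.pi * I / N) := by
    rw [hv] at hn
    have : w = n * (2 * Real.pi * I) - (2 * (Real.pi : ℂ) * I / (N : ℂ)) * q * a := by
      linear_combination hn
    rw [this]
    push_cast
    field_simp
  have hk : (n * N - q * a : ℤ) ≠ 0 := by
    intro h0
    rw [h0] at hwn
    exact hw (by simpa using hwn)
  have hnorm : ‖w‖ = |((n * N - q * a : ℤ) : ℝ)| * (2 * Real.pi / N) := by
    rw [hwn, norm_mul, Complex.norm_intCast]
    simp [abs_of_pos Real.pi_pos]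
  have h1k : (1 : ℝ) ≤ |((n * N - q * a : ℤ) : ℝ)| := by
    exact_mod_cast Int.one_le_abs hk
  have : 0 < 2 * Real.pi / N := by positivity
  nlinarith

/-- The function `f_{a,q}` of the twisted dynamical r-matrix. -/
noncomputable def twistedCoth (N q a : ℕ) (w : ℂ) : ℂ :=
  if a = 0 then (1 / 2 : ℂ) * coth (w / 2) - 1 / w
  else (1 / 2 : ℂ) * coth ((w + (2 * (Real.pi : ℂ) * I / (N : ℂ)) * q * a) / 2)

theorem twistedCoth_eq (N q a : ℕ) (w : ℂ) :
    twistedCoth N q a w =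
      (1 / 2 : ℂ) * coth ((w + (2 * (Real.pi : ℂ) * I / (N : ℂ)) * q * a) / 2)
        - (if a = 0 then 1 else 0) / w := by
  unfold twistedCoth
  split_ifs with h
  · simp [h]
  · simp

theorem twistedCoth_identity {N q a b : ℕ} (ha : a < N) (hb : b < N) {z w : ℂ}
    (hz : z ≠ 0) (hw : w ≠ 0) (hzw : z + w ≠ 0) (hzN : ‖z‖ < 2 * Real.pi / N)
    (hwN : ‖w‖ < 2 * Real.pi / N) (hzwN : ‖z + w‖ < 2 * Real.pi / N) :
    twistedCoth N q a z * twistedCoth N q b w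
      - twistedCoth N q ((a + b) % N) (z + w) * twistedCoth N q b w
      - twistedCoth N q ((a + b) % N) (z + w) * twistedCoth N q a z
      - (if (a + b) % N = 0 then 1 else 0) *
          ((twistedCoth N q b (-z) - twistedCoth N q b w) / (-z - w))
      - (if b = 0 then 1 else 0) *
          ((twistedCoth N q a (z + w) - twistedCoth N q a z) / w)
      - (if a = 0 then 1 else 0) *
          ((twistedCoth N q b (z + w) - twistedCoth N q b w) / z) + 1 / 4 = 0 := by
  have hN : N ≠ 0 := by omega
  have hNC : (N : ℂ) ≠ 0 := Nat.cast_ne_zero.mpr hN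
  have hdiv : (((a + b) % N : ℕ) : ℂ) + N * ((a + b) / N : ℕ) = a + b := by
    exact_mod_cast Nat.mod_add_div (a + b) N
  have hsum : (z + w + (2 * (Real.pi : ℂ) * I / (N : ℂ)) * q * (a + b)) / 2 =
      (z + w + (2 * (Real.pi : ℂ) * I / (N : ℂ)) * q * ((a + b) % N : ℕ)) / 2 +
        (q * ((a + b) / N) : ℕ) * (Real.pi * I) := by
    rw [← hdiv]
    push_cast
    field_simp
    ring
  have hS : twistedCoth N q ((a + b) % N) (z + w) =
      (1 / 2 : ℂ) * coth ((z + w + (2 * (Real.pi : ℂ) * I / (N : ℂ)) * q * (a + b)) / 2)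
        - (if (a + b) % N = 0 then 1 else 0) / (z + w) := by
    rw [twistedCoth_eq, hsum, coth_add_nat_mul_pi_mul_I]
  have hadd := coth_add (sinh_ne_zero_of_norm_lt (q := q) (a := a) hN hz hzN)
    (sinh_ne_zero_of_norm_lt (q := q) (a := b) hN hw hwN)
    (by
      have := sinh_ne_zero_of_norm_lt (q := q) (a := a + b) hN hzw hzwN
      convert this using 2
      push_cast
      ring)
  have e : (z + (2 * (Real.pi : ℂ) * I / (N : ℂ)) * q * a) / 2 +
      (w + (2 * (Real.pi : ℂ) * I / (N : ℂ)) * q * b) / 2 =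
      (z + w + (2 * (Real.pi : ℂ) * I / (N : ℂ)) * q * (a + b)) / 2 := by ring
  rw [e] at hadd
  have hb' : b = 0 → twistedCoth N q a (z + w) = twistedCoth N q ((a + b) % N) (z + w) := by
    rintro rfl
    rw [add_zero, Nat.mod_eq_of_lt ha]
  have ha' : a = 0 → twistedCoth N q b (z + w) = twistedCoth N q ((a + b) % N) (z + w) := by
    rintro rfl
    rw [zero_add, Nat.mod_eq_of_lt hb]
  have hab : a = 0 → ((a + b) % N = 0 ↔ b = 0) := by
    rintro rfl
    rw [zero_add, Nat.mod_eq_of_lt hb]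
  have hba : b = 0 → ((a + b) % N = 0 ↔ a = 0) := by
    rintro rfl
    rw [add_zero, Nat.mod_eq_of_lt ha]
  have hs' : (a + b) % N = 0 → twistedCoth N q b (-z) = -twistedCoth N q a z := by
    intro hs
    have hiff : a = 0 ↔ b = 0 := ⟨fun h => (hab h).mp hs, fun h => (hba h).mp hs⟩
    have h2 : (-z + (2 * (Real.pi : ℂ) * I / (N : ℂ)) * q * b) / 2 =
        -((z + (2 * (Real.pi : ℂ) * I / (N : ℂ)) * q * a) / 2) +
        (q * ((a + b) / N) : ℕ) * (Real.pi * I) := by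
      have hb2 : (b : ℂ) = N * ((a + b) / N : ℕ) - a := by
        rw [hs] at hdiv
        push_cast at hdiv ⊢
        linear_combination -hdiv
      rw [hb2]
      push_cast
      field_simp
      ring
    rw [twistedCoth_eq, twistedCoth_eq, h2, coth_add_nat_mul_pi_mul_I, coth_neg]
    simp only [hiff]
    rw [div_neg]
    ring
  have hA := twistedCoth_eq N q a z
  have hB := twistedCoth_eq N q b w
  generalize coth ((z + (2 * (Real.pi : ℂ) * I / (N : ℂ)) * q * a) / 2) = A at *
  generalize coth ((w + (2 * (Real.pi : ℂ) * I / (N : ℂ)) * q * b) / 2) = B at *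
  generalize coth ((z + w + (2 * (Real.pi : ℂ) * I / (N : ℂ)) * q * (a + b)) / 2) = S at *
  have hinv : (z + w)⁻¹ * w⁻¹ + (z + w)⁻¹ * z⁻¹ - z⁻¹ * w⁻¹ = 0 := by
    field_simp
    ring
  have hneg : (-z - w)⁻¹ = -(z + w)⁻¹ := by rw [← inv_neg]; ring_nf
  generalize twistedCoth N q b (-z) = fbz at *
  generalize twistedCoth N q a (z + w) = fazw at *
  generalize twistedCoth N q b (z + w) = fbzw at *
  generalize twistedCoth N q ((a + b) % N) (z + w) = fs at *
  generalize twistedCoth N q a z = fa at *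
  generalize twistedCoth N q b w = fb at *
  have ea : (if a = 0 then (1 : ℂ) else 0) * fbzw = (if a = 0 then (1 : ℂ) else 0) * fs := by
    split_ifs with h0
    · rw [ha' h0]
    · simp
  have eb : (if b = 0 then (1 : ℂ) else 0) * fazw = (if b = 0 then (1 : ℂ) else 0) * fs := by
    split_ifs with h0
    · rw [hb' h0]
    · simp
  have es : (if (a + b) % N = 0 then (1 : ℂ) else 0) * fbz =
      -((if (a + b) % N = 0 then (1 : ℂ) else 0) * fa) := by
    split_ifs with h0
    · rw [hs' h0]; ring
    · simp
  have eas : (if a = 0 then (1 : ℂ) else 0) * (if (a + b) % N = 0 then (1 : ℂ) else 0) =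
      (if a = 0 then (1 : ℂ) else 0) * (if b = 0 then (1 : ℂ) else 0) := by
    by_cases h0 : a = 0
    · simp [hab h0]
    · simp [h0]
  have ebs : (if b = 0 then (1 : ℂ) else 0) * (if (a + b) % N = 0 then (1 : ℂ) else 0) =
      (if a = 0 then (1 : ℂ) else 0) * (if b = 0 then (1 : ℂ) else 0) := by
    by_cases h0 : b = 0
    · rw [if_pos h0]
      simp only [hba h0, one_mul, mul_one]
    · simp [h0]
  generalize (if a = 0 then (1 : ℂ) else 0) = εa at *
  generalize (if b = 0 then (1 : ℂ) else 0) = εb at *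
  generalize (if (a + b) % N = 0 then (1 : ℂ) else 0) = εs at *
  simp only [div_eq_mul_inv, hneg] at *
  generalize z⁻¹ = zi at *
  generalize w⁻¹ = wi at *
  generalize (z + w)⁻¹ = si at *
  have : fa * fb - fs * fb - fs * fa - εs * fa * si - εs * fb * si - εb * fs * wi
      + εb * fa * wi - εa * fs * zi + εa * fb * zi + 1 / 4 = 0 := by
    subst hA hB hS
    linear_combination (-1 / 4) * hadd + si * wi * ebs + si * zi * eas + εa * εb * hinv
  linear_combination this + si * es - wi * eb - zi * ea

end Coth

section OperatorSeries

open Finset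

variable {G : Type*} [NormedAddCommGroup G] [NormedSpace ℂ G]

theorem norm_pow_apply_le (L : G →L[ℂ] G) {s : ℝ} (hs : ‖L‖ ≤ s) (n : ℕ) : ‖L ^ n‖ ≤ s ^ n := by
  induction n with
  | zero =>
    rw [pow_zero, pow_zero]
    exact ContinuousLinearMap.norm_id_le
  | succ n ih =>
    rw [pow_succ, pow_succ]
    exact (norm_mul_le _ _).trans
      (mul_le_mul ih hs (norm_nonneg _) ((norm_nonneg _).trans ih))

theorem summable_norm_smul_pow (L : G →L[ℂ] G) {c : ℕ → ℂ} {s : ℝ} (hs : ‖L‖ ≤ s)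
    (hc : Summable fun n => ‖c n‖ * s ^ n) : Summable fun n => ‖c n • L ^ n‖ := by
  refine Summable.of_nonneg_of_le (fun _ => norm_nonneg _) (fun n => ?_) hc
  rw [norm_smul]
  exact mul_le_mul_of_nonneg_left (norm_pow_apply_le L hs n) (norm_nonneg _)

theorem hasDerivAt_add_smul_pow_succ (L M : G →L[ℂ] G) (d : ℕ) :
    HasDerivAt (fun t : ℂ => (L + t • M) ^ (d + 1))
      (∑ p ∈ antidiagonal d, L ^ p.1 * M * L ^ p.2) 0 := by
  have h1 : HasDerivAt (fun t : ℂ => L + t • M) M 0 := by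
    simpa using ((hasDerivAt_id (0 : ℂ)).smul_const M).const_add L
  induction d with
  | zero => simpa using h1
  | succ d ih =>
    have := h1.mul ih
    simp only [pow_succ' _ (d + 1)]
    convert! this using 1
    rw [Finset.Nat.sum_antidiagonal_succ, Finset.mul_sum]
    simp [pow_succ', mul_assoc]

theorem hasSum_deriv_tsum_smul_pow [CompleteSpace G] (L M : G →L[ℂ] G) (X : G) {c : ℕ → ℂ} {s : ℝ}
    (hs : ‖L‖ < s) (hc : Summable fun n => ‖c n‖ * s ^ n) :
    HasSum (fun d => c (d + 1) • ∑ p ∈ antidiagonal d, (L ^ p.1) (M ((L ^ p.2) X)))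
      (deriv (fun t : ℂ => ∑' n, c n • ((L + t • M) ^ n) X) 0) := by
  have hU : IsOpen {t : ℂ | ‖L + t • M‖ < s} :=
    isOpen_lt (by fun_prop) continuous_const
  have h := Complex.hasSum_deriv_of_summable_norm (F := fun n (t : ℂ) => c n • ((L + t • M) ^ n) X)
    (u := fun n => ‖c n‖ * s ^ n * ‖X‖) (z := 0) (hc.mul_right ‖X‖) (fun n => ?_) hU
    (fun n t ht => ?_) (by simpa using hs)
  · have h0 := (hasSum_nat_add_iff (f := fun n => deriv (fun t : ℂ => c n • ((L + t • M) ^ n) X) 0)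
      (g := deriv (fun t : ℂ => ∑' n, c n • ((L + t • M) ^ n) X) 0) 1).mpr (by simpa using h)
    refine h0.congr_fun fun d => ?_
    have h1 := ((hasDerivAt_add_smul_pow_succ L M d).clm_apply (hasDerivAt_const (0 : ℂ) X)).const_smul
      (c (d + 1))
    refine Eq.trans ?_ h1.deriv.symm
    simp
  · have : Differentiable ℂ fun t : ℂ => c n • ((L + t • M) ^ n) X := by fun_prop
    exact this.differentiableOn
  · rw [norm_smul, mul_assoc]
    exact mul_le_mul_of_nonneg_left
      ((((L + t • M) ^ n).le_opNorm X).trans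
        (mul_le_mul_of_nonneg_right (norm_pow_apply_le _ (le_of_lt ht) n) (norm_nonneg _)))
      (norm_nonneg _)

theorem hasSum_bilinEval_cdybePart [CompleteSpace G] (β : G →L[ℂ] G →L[ℂ] G) (L : G →L[ℂ] G)
    (hL : ∀ u v, L (β u v) = β (L u) v + β u (L v)) {ca cb cs : ℕ → ℂ} {s : ℝ} (hs : ‖L‖ ≤ s)
    (ha : Summable fun n => ‖ca n‖ * s ^ n) (hb : Summable fun n => ‖cb n‖ * s ^ n)
    (hc : Summable fun n => ‖cs n‖ * s ^ n) {εa εb εs : ℂ} {X Y U V DA DB DS : G}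
    {R : G →L[ℂ] G}
    (hU : HasSum (fun n => ca n • (L ^ n) X) U) (hV : HasSum (fun n => cb n • (L ^ n) Y) V)
    (hR : HasSum (fun n => cs n • L ^ n) R)
    (hDA : HasSum (fun d => εa • cb (d + 1) •
      ∑ p ∈ antidiagonal d, (L ^ p.1) (β X ((L ^ p.2) Y))) DA)
    (hDB : HasSum (fun d => εb • ca (d + 1) •
      ∑ p ∈ antidiagonal d, (L ^ p.1) (β ((L ^ p.2) X) Y)) DB)
    (hDS : HasSum (fun d => εs • cb (d + 1) •
      ∑ p ∈ antidiagonal d, (-1 : ℂ) ^ p.1 • β ((L ^ p.1) X) ((L ^ p.2) Y)) DS) :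
    HasSum (fun d => bilinEval β L L X Y (cdybePart ca cb cs εa εb εs d))
      (β U V - R (β X V) - R (β U Y) - DS - DB - DA + (1 / 4 : ℂ) • β X Y) := by
  have hX : Summable fun n => ‖ca n • (L ^ n) X‖ := by
    refine Summable.of_nonneg_of_le (fun _ => norm_nonneg _) (fun n => ?_)
      ((summable_norm_smul_pow L hs ha).mul_right ‖X‖)
    exact (ca n • L ^ n).le_opNorm X
  have hY : Summable fun n => ‖cb n • (L ^ n) Y‖ := by
    refine Summable.of_nonneg_of_le (fun _ => norm_nonneg _) (fun n => ?_)
      ((summable_norm_smul_pow L hs hb).mul_right ‖Y‖)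
    exact (cb n • L ^ n).le_opNorm Y
  have hXY : Summable fun n => ‖β X (cb n • (L ^ n) Y)‖ :=
    Summable.of_nonneg_of_le (fun _ => norm_nonneg _) (fun n => (β X).le_opNorm _)
      (hY.mul_left _)
  have hYX : Summable fun n => ‖β (ca n • (L ^ n) X) Y‖ :=
    Summable.of_nonneg_of_le (fun _ => norm_nonneg _) (fun n => (β.flip Y).le_opNorm _)
      (hX.mul_left _)
  have hRn := summable_norm_smul_pow L hs hc
  have h1 := hasSum_bilin_antidiagonal β hU hV hX hY
  have h2 := hasSum_bilin_antidiagonal (ContinuousLinearMap.id ℂ (G →L[ℂ] G)) hR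
    ((β X).hasSum hV) hRn hXY
  have h3 := hasSum_bilin_antidiagonal (ContinuousLinearMap.id ℂ (G →L[ℂ] G)) hR
    ((β.flip Y).hasSum hU) hRn hYX
  have h4 : HasSum (fun d : ℕ => if d = 0 then (1 / 4 : ℂ) • β X Y else 0)
      ((1 / 4 : ℂ) • β X Y) := hasSum_ite_eq 0 _
  refine ((((((h1.sub h2).sub h3).sub hDS).sub hDB).sub hDA).add h4).congr_fun fun d => ?_
  simp only [cdybePart, map_add, map_sub]
  rw [map_smul, map_smul, map_smul, bilinEval_mulPart, bilinEval_mulPart_right β hL,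
    bilinEval_mulPart_left β hL, bilinEval_diffPart_right β hL, bilinEval_diffPart_left β hL,
    bilinEval_diffPart_neg]
  congr 1
  split_ifs with hd
  · rw [← mul_one (MvPolynomial.C (1 / 4 : ℂ)), ← MvPolynomial.smul_eq_C_mul, map_smul,
      bilinEval_one]
  · simp

end OperatorSeries

section Eigenspaces

variable {G : Type*} [AddCommGroup G] [Module ℂ G]

/-- An additive property holds everywhere as soon as it holds on the eigenspaces of a linear
automorphism of finite order. -/
theorem eigenvector_induction [FiniteDimensional ℂ G] {N : ℕ} (hN : 2 ≤ N) (μ : G ≃ₗ[ℂ] G)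
    (hμN : ∀ x, (⇑μ)^[N] x = x) {ζ : ℂ} (hζ : IsPrimitiveRoot ζ N) {motive : G → Prop}
    (eigen : ∀ a < N, ∀ ξ, μ ξ = ζ ^ a • ξ → motive ξ)
    (add : ∀ x y, motive x → motive y → motive (x + y)) (x : G) : motive x := by
  have : NeZero N := ⟨by omega⟩
  let f : Module.End ℂ G := μ
  have hiter : ∀ n x, (f ^ n) x = (⇑μ)^[n] x := fun n x => by
    rw [Module.End.pow_apply]
    rfl
  have hfN : f ^ N = 1 := LinearMap.ext fun x => by rw [hiter, hμN]; rfl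
  have hss : f.IsSemisimple := by
    refine Module.End.isSemisimple_of_squarefree_aeval_eq_zero
      (p := Polynomial.X ^ N - Polynomial.C 1) ?_ (by simp [hfN])
    exact (Polynomial.separable_X_pow_sub_C (1 : ℂ)
      (Nat.cast_ne_zero.mpr (by omega)) one_ne_zero).squarefree
  have hzero : motive 0 := eigen 0 (by omega) 0 (by simp)
  have hx : x ∈ ⨆ l : ℂ, f.eigenspace l := by
    rw [hss.iSup_eigenspace_eq_top]
    trivial
  refine Submodule.iSup_induction (p := fun l => f.eigenspace l) (motive := motive) hx
    (fun l ξ hξ => ?_) hzero add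
  by_cases h0 : ξ = 0
  · exact h0 ▸ hzero
  have hξ' : f ξ = l • ξ := Module.End.mem_eigenspace_iff.mp hξ
  have hpow : ∀ n, (f ^ n) ξ = l ^ n • ξ := fun n => by
    induction n with
    | zero => simp
    | succ n ih => rw [pow_succ', Module.End.mul_apply, ih, map_smul, hξ', smul_smul, pow_succ]
  have hl : l ^ N = 1 := by
    have h1 : (l ^ N - 1) • ξ = 0 := by
      rw [sub_smul, ← hpow, hfN]
      simp
    exact sub_eq_zero.mp ((smul_eq_zero.mp h1).resolve_right h0)
  obtain ⟨a, ha, rfl⟩ := hζ.eq_pow_of_pow_eq_one hl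
  exact eigen a ha ξ hξ'

theorem bilin_fixed_eigenvector_eq_zero (μ : G ≃ₗ[ℂ] G) (B : G →ₗ[ℂ] G →ₗ[ℂ] ℂ)
    (hμB : ∀ x y, B (μ x) (μ y) = B x y) {l : ℂ} (hl : l ≠ 1) {x y : G} (hx : μ x = x)
    (hy : μ y = l • y) : B x y = 0 := by
  have h := hμB x y
  rw [hx, hy, map_smul, smul_eq_mul] at h
  have h1 : (l - 1) * B x y = 0 := by linear_combination h
  exact (mul_eq_zero.mp h1).resolve_left (sub_ne_zero.mpr hl)

theorem sum_dual_basis_fixed [FiniteDimensional ℂ G] {N : ℕ} (hN : 2 ≤ N) (μ : G ≃ₗ[ℂ] G)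
    (hμN : ∀ x, (⇑μ)^[N] x = x) {ζ : ℂ} (hζ : IsPrimitiveRoot ζ N)
    (B : G →ₗ[ℂ] G →ₗ[ℂ] ℂ) (hBsymm : ∀ x y, B x y = B y x)
    (hBnd : ∀ x, (∀ y, B x y = 0) → x = 0) (hμB : ∀ x y, B (μ x) (μ y) = B x y)
    {ι : Type*} [Fintype ι] [DecidableEq ι] (K K' : ι → G) (hK'fix : ∀ i, μ (K' i) = K' i)
    (hdual : ∀ i j, B (K i) (K' j) = if i = j then 1 else 0)
    (hKspan : ∀ x : G, μ x = x → x ∈ Submodule.span ℂ (Set.range K)) {Z : G} (hZ : μ Z = Z) :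
    ∑ i, B (K i) Z • K' i = Z := by
  refine (sub_eq_zero.mp (hBnd (Z - ∑ i, B (K i) Z • K' i) fun y => ?_)).symm
  have hW : μ (Z - ∑ i, B (K i) Z • K' i) = Z - ∑ i, B (K i) Z • K' i := by
    simp [map_sum, hZ, hK'fix]
  have hWK : ∀ j, B (Z - ∑ i, B (K i) Z • K' i) (K j) = 0 := fun j => by
    rw [hBsymm]
    simp [map_sum, hdual]
  generalize Z - ∑ i, B (K i) Z • K' i = W at *
  induction y using eigenvector_induction hN μ hμN hζ with
  | eigen a ha ξ hξ =>
    by_cases h0 : a = 0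
    · subst h0
      refine Submodule.span_induction (p := fun x _ => B W x = 0) ?_ (by simp) ?_ ?_
        (hKspan ξ (by simpa using hξ))
      · rintro _ ⟨j, rfl⟩
        exact hWK j
      · intro x y _ _ hx hy
        rw [map_add, hx, hy, add_zero]
      · intro t x _ hx
        rw [map_smul, hx, smul_zero]
    · exact bilin_fixed_eigenvector_eq_zero μ B hμB (hζ.pow_ne_one_of_pos_of_lt h0 ha) hW hξ
  | add x y hx hy => rw [map_add, hx, hy, add_zero]

end Eigenspaces

set_option maxHeartbeats 800000 in
/-- (Appendix B of the paper.)  Let `𝔊` be a finite-dimensional complex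
Lie algebra (a finite-dimensional normed `ℂ`-space with a continuous bilinear bracket
satisfying the Lie axioms) with a nondegenerate, symmetric, invariant bilinear form `B`,
`μ` a `B`-preserving Lie algebra automorphism with `μ^N = id`, `N ≥ 2`,
`ζ := exp(2πi/N)`, eigenspaces `𝔊_a := ker(μ − ζ^a)`, nonzero fixed-point subalgebra
`𝔊₀`, dual bases `(K_i)`, `(K^i)` of `𝔊₀`, the projection `P₀` onto `𝔊₀` along the
other eigenspaces, an integer `q` with `1 ≤ q ≤ N−1` and `qa ∉ Nℤ∖{0}` whenever
`𝔊_a ≠ 0`, power series coefficients `c_{a,n}` with `∑ c_{a,n}w^n` absolutely convergent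
to `f_{a,q}(w)` for `‖w‖ < r` (`w ≠ 0` when `a = 0`), the r-matrix
`ρ(ω)ξ = ∑ c_{a,n}(ad ω)^n ξ` on `U = {ω ∈ 𝔊₀ : ‖ad ω‖ < r}`, and the directional
derivatives `(∇_T ρ)(ω)`.  Then for every `ω ∈ U` and all `X, Y ∈ 𝔊` the modified
classical dynamical Yang–Baxter equation holds:
`[ρX, ρY] − ρ([X, ρY] + [ρX, Y]) + ∑ᵢ B(X, (∇_{K_i}ρ)Y)·K^i + (∇_{Y₀}ρ)X − (∇_{X₀}ρ)Y
  = −(1/4)[X, Y]`. -/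
theorem rho_q_satisfies_CDYBE {G : Type*} [NormedAddCommGroup G] [NormedSpace ℂ G]
    [FiniteDimensional ℂ G]
    (bracket : G →L[ℂ] G →L[ℂ] G)
    (halt : ∀ x : G, bracket x x = 0)
    (hleib : ∀ x y z : G,
      bracket x (bracket y z) = bracket (bracket x y) z + bracket y (bracket x z))
    (B : G →ₗ[ℂ] G →ₗ[ℂ] ℂ)
    (hBsymm : ∀ x y, B x y = B y x)
    (hBnd : ∀ x, (∀ y, B x y = 0) → x = 0)
    (hBinv : ∀ x y z, B (bracket x y) z + B y (bracket x z) = 0)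
    (N : ℕ) (hN : 2 ≤ N)
    (μ : G ≃ₗ[ℂ] G) (hμN : ∀ x, (⇑μ)^[N] x = x)
    (hμbr : ∀ x y, μ (bracket x y) = bracket (μ x) (μ y))
    (hμB : ∀ x y, B (μ x) (μ y) = B x y)
    (ζ : ℂ) (hζ : ζ = Complex.exp (2 * (Real.pi : ℂ) * I / (N : ℂ)))
    (hG0 : ∃ x : G, x ≠ 0 ∧ μ x = x)
    (q : ℕ) (hq1 : 1 ≤ q) (hq2 : q ≤ N - 1)
    (hq : ∀ a : ℕ, 1 ≤ a → a < N → (∃ ξ : G, ξ ≠ 0 ∧ μ ξ = ζ ^ a • ξ) → ¬ (N ∣ q * a))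
    {ι : Type*} [Fintype ι] [DecidableEq ι] (K K' : ι → G)
    (hKfix : ∀ i, μ (K i) = K i) (hK'fix : ∀ i, μ (K' i) = K' i)
    (hdual : ∀ i j, B (K i) (K' j) = if i = j then 1 else 0)
    (hKspan : ∀ x : G, μ x = x → x ∈ Submodule.span ℂ (Set.range K))
    (P0 : G →ₗ[ℂ] G)
    (hP0fix : ∀ ξ : G, μ ξ = ξ → P0 ξ = ξ)
    (hP0zero : ∀ a : ℕ, 1 ≤ a → a < N → ∀ ξ : G, μ ξ = ζ ^ a • ξ → P0 ξ = 0)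
    (r : ℝ) (hr : 0 < r) (c : ℕ → ℕ → ℂ)
    (hc : ∀ a : ℕ, a < N → (∃ ξ : G, ξ ≠ 0 ∧ μ ξ = ζ ^ a • ξ) →
      ∀ w : ℂ, ‖w‖ < r → (a = 0 → w ≠ 0) →
        Summable (fun n : ℕ => ‖c a n * w ^ n‖) ∧
        ∑' n : ℕ, c a n * w ^ n =
          if a = 0 then (1 / 2 : ℂ) * coth (w / 2) - 1 / w
          else (1 / 2 : ℂ) * coth ((w + (2 * (Real.pi : ℂ) * I / (N : ℂ)) * q * a) / 2))
    (ρ : G → G →L[ℂ] G)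
    (hρ : ∀ ω : G, μ ω = ω → ‖bracket ω‖ < r → ∀ a : ℕ, a < N →
      ∀ ξ : G, μ ξ = ζ ^ a • ξ →
        HasSum (fun n : ℕ => c a n • ((bracket ω ^ n) ξ)) (ρ ω ξ))
    (Dρ : G → G → G → G)
    (hDρ : ∀ T : G, μ T = T → ∀ ω : G, μ ω = ω → ‖bracket ω‖ < r → ∀ X : G,
      HasDerivAt (fun t : ℂ => ρ (ω + t • T) X) (Dρ T ω X) 0)
    (ω : G) (hω : μ ω = ω) (hωr : ‖bracket ω‖ < r) (X Y : G) :
    bracket (ρ ω X) (ρ ω Y)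
      - ρ ω (bracket X (ρ ω Y) + bracket (ρ ω X) Y)
      + (∑ i, B X (Dρ (K i) ω Y) • K' i)
      + Dρ (P0 Y) ω X - Dρ (P0 X) ω Y
      = -(1 / 4 : ℂ) • bracket X Y := by
  have hN0 : N ≠ 0 := by omega
  have hprim : IsPrimitiveRoot ζ N := hζ ▸ Complex.isPrimitiveRoot_exp N hN0
  have hanti : ∀ x y, bracket x y = -bracket y x := fun x y => by
    have := halt (x + y)
    simp only [map_add, add_apply, halt, zero_add, add_zero] at this
    exact eq_neg_of_add_eq_zero_right this
  obtain ⟨s₀, hs₀, hs₀r⟩ := exists_between hωr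
  have hs₀pos : 0 < s₀ := (norm_nonneg _).trans_lt hs₀
  have hsum : ∀ a < N, (∃ ξ : G, ξ ≠ 0 ∧ μ ξ = ζ ^ a • ξ) →
      Summable fun n => ‖c a n‖ * s₀ ^ n := fun a ha hξ => by
    have h := (hc a ha hξ (s₀ : ℂ) (by simpa [abs_of_pos hs₀pos] using hs₀r)
      fun _ => by exact_mod_cast hs₀pos.ne').1
    simpa [abs_of_pos hs₀pos] using h
  have hser : ∀ a < N, (∃ ξ : G, ξ ≠ 0 ∧ μ ξ = ζ ^ a • ξ) → ∀ z : ℂ, z ≠ 0 → ‖z‖ < r →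
      HasSum (fun n => c a n * z ^ n) (twistedCoth N q a z) := fun a ha hξ z hz hzr => by
    have h := hc a ha hξ z hzr fun _ => hz
    have h2 : ∑' n : ℕ, c a n * z ^ n = twistedCoth N q a z := h.2
    exact h2 ▸ h.1.of_norm.hasSum
  have hDsum : ∀ T, μ T = T → ∀ a < N, ∀ ξ : G, ξ ≠ 0 → μ ξ = ζ ^ a • ξ →
      HasSum (fun d => c a (d + 1) • ∑ p ∈ Finset.HasAntidiagonal.antidiagonal d,
        (bracket ω ^ p.1) (bracket T ((bracket ω ^ p.2) ξ))) (Dρ T ω ξ) := by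
    intro T hT a ha ξ hξ0 hξ
    have h1 := hasSum_deriv_tsum_smul_pow (bracket ω) (bracket T) ξ hs₀ (hsum a ha ⟨ξ, hξ0, hξ⟩)
    convert h1 using 1
    rw [← (hDρ T hT ω hω hωr ξ).deriv]
    refine Filter.EventuallyEq.deriv_eq ?_
    have hcont : Continuous fun t : ℂ => ‖bracket (ω + t • T)‖ := by fun_prop
    filter_upwards [hcont.continuousAt.eventually_lt continuousAt_const
      (by simpa using hωr : ‖bracket (ω + (0 : ℂ) • T)‖ < r)] with t ht
    have h2 := (hρ (ω + t • T) (by rw [map_add, map_smul, hω, hT]) ht a ha ξ hξ).tsum_eq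
    simpa using h2.symm
  have hDadd : ∀ T, μ T = T → ∀ x y, Dρ T ω (x + y) = Dρ T ω x + Dρ T ω y := fun T hT x y => by
    have h1 := (hDρ T hT ω hω hωr x).add (hDρ T hT ω hω hωr y)
    refine (hDρ T hT ω hω hωr (x + y)).unique (h1.congr_of_eventuallyEq ?_)
    exact Filter.Eventually.of_forall fun t => map_add _ _ _
  have hDzero : ∀ T, μ T = T → Dρ T ω 0 = 0 := fun T hT => by
    simpa using hDadd T hT 0 0
  have hDadd' : ∀ T, μ T = T → ∀ T', μ T' = T' → ∀ x,
      Dρ (T + T') ω x = Dρ T ω x + Dρ T' ω x := by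
    intro T hT T' hT' x
    have hTT' : μ (T + T') = T + T' := by rw [map_add, hT, hT']
    induction x using eigenvector_induction hN μ hμN hprim with
    | eigen a ha ξ hξ =>
      by_cases h0 : ξ = 0
      · rw [h0, hDzero _ hT, hDzero _ hT', hDzero _ hTT', add_zero]
      · refine (hDsum _ hTT' a ha ξ h0 hξ).unique ?_
        refine ((hDsum _ hT a ha ξ h0 hξ).add (hDsum _ hT' a ha ξ h0 hξ)).congr_fun fun d => ?_
        simp only [map_add, add_apply, Finset.sum_add_distrib, smul_add]
    | add x y hx hy => rw [hDadd _ hT, hDadd _ hT', hDadd _ hTT', hx, hy]; abel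
  have hDzero' : ∀ x, Dρ 0 ω x = 0 := fun x => by
    simpa using hDadd' 0 (map_zero μ) 0 (map_zero μ) x
  have hP0 : ∀ x, μ (P0 x) = P0 x := fun x => by
    induction x using eigenvector_induction hN μ hμN hprim with
    | eigen a ha ξ hξ =>
      by_cases h0 : a = 0
      · have hξ' : μ ξ = ξ := by simpa [h0] using hξ
        rw [hP0fix ξ hξ', hξ']
      · rw [hP0zero a (by omega) ha ξ hξ, map_zero]
    | add x y hx hy => rw [map_add, map_add, hx, hy]
  have hLμ : ∀ n x, μ ((bracket ω ^ n) x) = (bracket ω ^ n) (μ x) := fun n x => by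
    induction n with
    | zero => simp
    | succ n ih =>
      rw [pow_succ', mul_apply_eq_comp, mul_apply_eq_comp, hμbr, hω, ih]
  have hρμ : ∀ a < N, ∀ ξ, μ ξ = ζ ^ a • ξ → μ (ρ ω ξ) = ζ ^ a • ρ ω ξ := fun a ha ξ hξ => by
    have h := hρ ω hω hωr a ha ξ hξ
    have h1 := (LinearMap.toContinuousLinearMap (μ : G →ₗ[ℂ] G)).hasSum h
    refine h1.unique ((h.const_smul (ζ ^ a)).congr_fun fun n => ?_)
    change μ (c a n • (bracket ω ^ n) ξ) = _
    rw [map_smul, hLμ, hξ, map_smul, smul_comm]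
  have hbrμ : ∀ a b x y, μ x = ζ ^ a • x → μ y = ζ ^ b • y →
      μ (bracket x y) = ζ ^ ((a + b) % N) • bracket x y := fun a b x y hx hy => by
    rw [hμbr, hx, hy, map_smul, map_smul, smul_apply, smul_smul,
      ← pow_add, add_comm b a, pow_eq_pow_mod (a + b) hprim.pow_eq_one]
  have hS : ∀ s < N, ∀ Z, μ Z = ζ ^ s • Z →
      ∑ i, B (K i) Z • K' i = (if s = 0 then (1 : ℂ) else 0) • Z := by
    intro s hs Z hZ
    split_ifs with h0
    · rw [one_smul]
      exact sum_dual_basis_fixed hN μ hμN hprim B hBsymm hBnd hμB K K' hK'fix hdual hKspan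
        (by simpa [h0] using hZ)
    · rw [zero_smul]
      refine Finset.sum_eq_zero fun i _ => ?_
      rw [bilin_fixed_eigenvector_eq_zero μ B hμB (hprim.pow_ne_one_of_pos_of_lt h0 hs)
        (hKfix i) hZ, zero_smul]
  have hBpow : ∀ n x y, B x ((bracket ω ^ n) y) = (-1) ^ n * B ((bracket ω ^ n) x) y := by
    intro n
    induction n with
    | zero => simp
    | succ n ih =>
      intro x y
      have h1 : (bracket ω ^ (n + 1)) y = (bracket ω ^ n) (bracket ω y) := by
        rw [pow_succ, mul_apply_eq_comp]
      have h2 : (bracket ω ^ (n + 1)) x = bracket ω ((bracket ω ^ n) x) := by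
        rw [pow_succ', mul_apply_eq_comp]
      rw [h1, h2, ih, eq_neg_of_add_eq_zero_right (hBinv _ _ _)]
      ring
  have hBK : ∀ i x y, B x (bracket (K i) y) = -B (K i) (bracket x y) := fun i x y => by
    rw [eq_neg_of_add_eq_zero_right (hBinv (K i) x y), hanti (K i) x, map_neg,
      LinearMap.neg_apply, eq_neg_of_add_eq_zero_right (hBinv x (K i) y)]
  have core : ∀ a < N, ∀ x, μ x = ζ ^ a • x → ∀ b < N, ∀ y, μ y = ζ ^ b • y →
      bracket (ρ ω x) (ρ ω y) - ρ ω (bracket x (ρ ω y) + bracket (ρ ω x) y)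
        + (∑ i, B x (Dρ (K i) ω y) • K' i) + Dρ (P0 y) ω x - Dρ (P0 x) ω y
        = -(1 / 4 : ℂ) • bracket x y := by
    intro a ha x hx b hb y hy
    by_cases hx0 : x = 0
    · simp [hx0, hDzero _ (hP0 _), hDzero']
    by_cases hy0 : y = 0
    · simp [hy0, hDzero _ (hP0 _), hDzero', hDzero _ (hKfix _)]
    have hsN : (a + b) % N < N := Nat.mod_lt _ (Nat.pos_of_ne_zero hN0)
    have hxe : ∃ ξ : G, ξ ≠ 0 ∧ μ ξ = ζ ^ a • ξ := ⟨x, hx0, hx⟩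
    have hye : ∃ ξ : G, ξ ≠ 0 ∧ μ ξ = ζ ^ b • ξ := ⟨y, hy0, hy⟩
    have hDA : HasSum (fun d => (if a = 0 then (1 : ℂ) else 0) • c b (d + 1) •
        ∑ p ∈ Finset.HasAntidiagonal.antidiagonal d,
          (bracket ω ^ p.1) (bracket x ((bracket ω ^ p.2) y)))
        (Dρ (P0 x) ω y) := by
      split_ifs with h0
      · have hx' : μ x = x := by simpa [h0] using hx
        simp only [one_smul]
        rw [hP0fix x hx']
        exact hDsum x hx' b hb y hy0 hy
      · simp only [zero_smul]
        rw [hP0zero a (by omega) ha x hx, hDzero']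
        exact hasSum_zero
    have hDB : HasSum (fun d => (if b = 0 then (1 : ℂ) else 0) • c a (d + 1) •
        ∑ p ∈ Finset.HasAntidiagonal.antidiagonal d,
          (bracket ω ^ p.1) (bracket ((bracket ω ^ p.2) x) y))
        (-Dρ (P0 y) ω x) := by
      split_ifs with h0
      · have hy' : μ y = y := by simpa [h0] using hy
        simp only [one_smul]
        rw [hP0fix y hy']
        refine (hDsum y hy' a ha x hx0 hx).neg.congr_fun fun d => ?_
        rw [← smul_neg, ← Finset.sum_neg_distrib]
        refine congrArg _ (Finset.sum_congr rfl fun p _ => ?_)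
        rw [hanti, map_neg]
      · simp only [zero_smul]
        rw [hP0zero b (by omega) hb y hy, hDzero', neg_zero]
        exact hasSum_zero
    have hDS : HasSum (fun d => (if (a + b) % N = 0 then (1 : ℂ) else 0) • c b (d + 1) •
        ∑ p ∈ Finset.HasAntidiagonal.antidiagonal d,
          (-1 : ℂ) ^ p.1 • bracket ((bracket ω ^ p.1) x) ((bracket ω ^ p.2) y))
        (-∑ i, B x (Dρ (K i) ω y) • K' i) := by
      have h1 : ∀ i, HasSum (fun d => B x (c b (d + 1) •
          ∑ p ∈ Finset.HasAntidiagonal.antidiagonal d,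
          (bracket ω ^ p.1) (bracket (K i) ((bracket ω ^ p.2) y))) • K' i)
          (B x (Dρ (K i) ω y) • K' i) := fun i =>
        ((LinearMap.toContinuousLinearMap (B x)).hasSum
          (hDsum (K i) (hKfix i) b hb y hy0 hy)).smul_const (K' i)
      refine (hasSum_sum fun i (_ : i ∈ Finset.univ) => h1 i).neg.congr_fun fun d => ?_
      rw [smul_comm, Finset.smul_sum, Finset.smul_sum]
      simp only [map_smul, map_sum, hBpow, hBK, smul_eq_mul, Finset.mul_sum, Finset.sum_smul]
      rw [Finset.sum_comm, ← Finset.sum_neg_distrib]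
      refine Finset.sum_congr rfl fun p _ => ?_
      rw [smul_comm _ ((-1 : ℂ) ^ p.1), ← hS _ hsN _ (hbrμ a b _ _ (by rw [hLμ, hx, map_smul])
        (by rw [hLμ, hy, map_smul])), Finset.smul_sum, Finset.smul_sum, ← Finset.sum_neg_distrib]
      refine Finset.sum_congr rfl fun i _ => ?_
      rw [smul_smul, smul_smul, ← neg_smul]
      congr 1
      ring
    by_cases hse : ∃ ξ : G, ξ ≠ 0 ∧ μ ξ = ζ ^ ((a + b) % N) • ξ
    · have hRn := summable_norm_smul_pow (bracket ω) hs₀.le (hsum _ hsN hse)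
      have hR := hRn.of_norm.hasSum
      have hρR : ∀ Z, μ Z = ζ ^ ((a + b) % N) • Z →
          ρ ω Z = (∑' n, c ((a + b) % N) n • bracket ω ^ n) Z := fun Z hZ => by
        have h1 := (ContinuousLinearMap.apply ℂ G Z).hasSum hR
        exact (hρ ω hω hωr _ hsN Z hZ).unique h1
      have htot := hasSum_bilinEval_cdybePart bracket (bracket ω) (hleib ω) hs₀.le
        (hsum a ha hxe) (hsum b hb hye) (hsum _ hsN hse) (hρ ω hω hωr a ha x hx)
        (hρ ω hω hωr b hb y hy) hR hDA hDB hDS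
      have hδ : 0 < min r (2 * Real.pi / N) := lt_min hr
        (div_pos (by positivity) (Nat.cast_pos.mpr (Nat.pos_of_ne_zero hN0)))
      have hpart := cdybePart_eq_zero hδ
        (fun z hz hzδ => hser a ha hxe z hz (hzδ.trans_le (min_le_left _ _)))
        (fun z hz hzδ => hser b hb hye z hz (hzδ.trans_le (min_le_left _ _)))
        (fun z hz hzδ => hser _ hsN hse z hz (hzδ.trans_le (min_le_left _ _)))
        (fun z w hz hw hzw hzδ hwδ hzwδ => twistedCoth_identity (q := q) ha hb hz hw hzw
          (hzδ.trans_le (min_le_right _ _)) (hwδ.trans_le (min_le_right _ _))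
          (hzwδ.trans_le (min_le_right _ _)))
      simp only [hpart, map_zero] at htot
      have h0 := htot.unique hasSum_zero
      rw [map_add (ρ ω), hρR _ (hbrμ a b _ _ hx (hρμ b hb y hy)),
        hρR _ (hbrμ a b _ _ (hρμ a ha x hx) hy), neg_smul]
      rw [← sub_eq_zero, ← h0]
      abel
    · have hz : ∀ Z, μ Z = ζ ^ ((a + b) % N) • Z → Z = 0 := fun Z hZ => by
        by_contra hne
        exact hse ⟨Z, hne, hZ⟩
      have hLe : ∀ n, μ ((bracket ω ^ n) x) = ζ ^ a • (bracket ω ^ n) x := fun n => by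
        rw [hLμ, hx, map_smul]
      have hLe' : ∀ n, μ ((bracket ω ^ n) y) = ζ ^ b • (bracket ω ^ n) y := fun n => by
        rw [hLμ, hy, map_smul]
      have hDA0 := hDA.unique (by
        simpa only [hz _ (hbrμ a b _ _ hx (hLe' _)), map_zero, Finset.sum_const_zero, smul_zero]
          using hasSum_zero)
      have hDB0 := hDB.unique (by
        simpa only [hz _ (hbrμ a b _ _ (hLe _) hy), map_zero, Finset.sum_const_zero, smul_zero]
          using hasSum_zero)
      have hDS0 := hDS.unique (by
        simpa only [hz _ (hbrμ a b _ _ (hLe _) (hLe' _)), Finset.sum_const_zero, smul_zero]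
          using hasSum_zero)
      rw [hz _ (hbrμ a b _ _ (hρμ a ha x hx) (hρμ b hb y hy)),
        hz _ (hbrμ a b _ _ hx (hρμ b hb y hy)), hz _ (hbrμ a b _ _ (hρμ a ha x hx) hy),
        hz _ (hbrμ a b _ _ hx hy), hDA0, neg_eq_zero.mp hDB0, neg_eq_zero.mp hDS0]
      simp
  have addX : ∀ x x' y,
      bracket (ρ ω (x + x')) (ρ ω y) - ρ ω (bracket (x + x') (ρ ω y) + bracket (ρ ω (x + x')) y)
        + (∑ i, B (x + x') (Dρ (K i) ω y) • K' i) + Dρ (P0 y) ω (x + x') - Dρ (P0 (x + x')) ω y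
      = (bracket (ρ ω x) (ρ ω y) - ρ ω (bracket x (ρ ω y) + bracket (ρ ω x) y)
        + (∑ i, B x (Dρ (K i) ω y) • K' i) + Dρ (P0 y) ω x - Dρ (P0 x) ω y)
      + (bracket (ρ ω x') (ρ ω y) - ρ ω (bracket x' (ρ ω y) + bracket (ρ ω x') y)
        + (∑ i, B x' (Dρ (K i) ω y) • K' i) + Dρ (P0 y) ω x' - Dρ (P0 x') ω y) := by
    intro x x' y
    rw [map_add P0, hDadd' _ (hP0 _) _ (hP0 _), hDadd _ (hP0 _)]
    simp only [map_add, add_apply, LinearMap.add_apply, add_smul, Finset.sum_add_distrib]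
    abel
  have addY : ∀ x y y',
      bracket (ρ ω x) (ρ ω (y + y')) - ρ ω (bracket x (ρ ω (y + y')) + bracket (ρ ω x) (y + y'))
        + (∑ i, B x (Dρ (K i) ω (y + y')) • K' i) + Dρ (P0 (y + y')) ω x - Dρ (P0 x) ω (y + y')
      = (bracket (ρ ω x) (ρ ω y) - ρ ω (bracket x (ρ ω y) + bracket (ρ ω x) y)
        + (∑ i, B x (Dρ (K i) ω y) • K' i) + Dρ (P0 y) ω x - Dρ (P0 x) ω y)
      + (bracket (ρ ω x) (ρ ω y') - ρ ω (bracket x (ρ ω y') + bracket (ρ ω x) y')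
        + (∑ i, B x (Dρ (K i) ω y') • K' i) + Dρ (P0 y') ω x - Dρ (P0 x) ω y') := by
    intro x y y'
    rw [map_add P0, hDadd' _ (hP0 _) _ (hP0 _), hDadd _ (hP0 _)]
    simp only [map_add, hDadd _ (hKfix _), add_smul, Finset.sum_add_distrib]
    abel
  induction X using eigenvector_induction hN μ hμN hprim with
  | eigen a ha x hx =>
    induction Y using eigenvector_induction hN μ hμN hprim with
    | eigen b hb y hy => exact core a ha x hx b hb y hy
    | add y y' hy hy' => rw [addY, hy, hy', map_add, smul_add]
  | add x x' hx hx' => rw [addX, hx, hx', map_add, add_apply, smul_add]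
end
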